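/- Let μ_∅ be a probability measure on ℕ with finite mean and μ a critical aperiodic probability measure on ℤ₊ belonging to the domain of attraction of a stable law of index α ∈ (1,2]. For a plane tree τ, let M(τ) be the size of the largest subtree grafted on a child of the root. Then M/n → 1 in probability under BGW_n^{μ_∅,μ}: for every ε > 0, BGW_n^{μ_∅,μ}(M ≤ (1−ε)n) → 0 as n → ∞. -/

import Mathlib

open Filter Set

noncomputable section

/-- A plane tree in Neveu's formalism: a finite set of finite words of positive integers,
containing the root `[]`, closed under prefixes, and such that the children of a vertex `u`
are `u1, …, u k_u`. -/
structure PlaneTree where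
  verts : Finset (List ℕ)
  root_mem : [] ∈ verts
  prefix_closed : ∀ u v : List ℕ, u <+: v → v ∈ verts → u ∈ verts
  labels_pos : ∀ u ∈ verts, ∀ i ∈ u, 1 ≤ i
  children_closed : ∀ (u : List ℕ) (i : ℕ), 1 ≤ i → u ++ [i + 1] ∈ verts → u ++ [i] ∈ verts

namespace PlaneTree

/-- The number of children of the vertex `u` in `τ`. -/
def kc (τ : PlaneTree) (u : List ℕ) : ℕ := Set.ncard {i : ℕ | u ++ [i] ∈ τ.verts}

/-- The number of vertices of the subtree grafted on `u` (that is, `u` and its descendants). -/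
def subtreeSize (τ : PlaneTree) (u : List ℕ) : ℕ :=
  Set.ncard {v : List ℕ | v ∈ τ.verts ∧ u <+: v}

/-- `M(τ)`: the size of the largest subtree grafted on a child of the root of `τ`. -/
def maxSub (τ : PlaneTree) : ℕ := (Finset.Icc 1 (τ.kc [])).sup fun i => τ.subtreeSize [i]

end PlaneTree

/-- The Bienaymé–Galton–Watson weight `BGW^μ(τ) = ∏_{u ∈ τ} μ(k_u)` of a plane tree. -/
def bgwW (μ : ℕ → ℝ) (τ : PlaneTree) : ℝ := ∏ u ∈ τ.verts, μ (τ.kc u)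

/-- The modified Bienaymé–Galton–Watson weight of a plane tree: the root reproduces according
to `μ0` and the other vertices according to `μ`. -/
def bgwModW (μ0 μ : ℕ → ℝ) (τ : PlaneTree) : ℝ :=
  μ0 (τ.kc []) * ∏ u ∈ τ.verts.erase [], μ (τ.kc u)

/-- The total mass `BGW^{μ0,μ}(T_n)` given by the modified Bienaymé–Galton–Watson measure to
plane trees with `n` vertices. -/
def bgwModMass (μ0 μ : ℕ → ℝ) (n : ℕ) : ℝ :=
  ∑ᶠ τ ∈ {τ : PlaneTree | τ.verts.card = n}, bgwModW μ0 μ τ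

/-- `μ` belongs to the domain of attraction of a stable law of index `α ∈ (1,2]`: either
`α = 2` and `μ` has finite variance, or `α < 2` and the tail `μ([n,∞))` equals `g(n) n^{-α}`
for a slowly varying function `g`. -/
def DomAttr (μ : ℕ → ℝ) (α : ℝ) : Prop :=
  (α = 2 ∧ Summable fun k : ℕ => (k : ℝ) ^ 2 * μ k) ∨
  (α < 2 ∧ ∃ g : ℝ → ℝ, (∀ x : ℝ, 0 < x → 0 < g x) ∧
    (∀ c : ℝ, 0 < c → Tendsto (fun x => g (c * x) / g x) atTop (nhds 1)) ∧
    ∀ n : ℕ, 1 ≤ n → (∑' k : ℕ, {m : ℕ | n ≤ m}.indicator μ k) = g n * (n : ℝ) ^ (-α))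


/-! ### Decomposition of plane trees at the root -/

namespace PlaneTree

theorem ext' {τ σ : PlaneTree} (h : τ.verts = σ.verts) : τ = σ := by
  cases τ; cases σ; simp_all

def consEmb (i : ℕ) : List ℕ ↪ List ℕ := ⟨fun u => i :: u, fun a b h => by simpa using h⟩

@[simp] theorem consEmb_apply (i : ℕ) (u : List ℕ) : consEmb i u = i :: u := rfl

/-- Graft a finite family of trees on a common root. -/
def graft (j : ℕ) (ts : Fin j → PlaneTree) : PlaneTree where
  verts := insert [] (Finset.univ.biUnion fun i : Fin j => (ts i).verts.map (consEmb (i + 1)))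
  root_mem := Finset.mem_insert_self _ _
  prefix_closed := by
    intro u v huv hv
    rw [Finset.mem_insert] at hv ⊢
    rcases hv with rfl | hv
    · left; simpa using huv
    · rcases u with _ | ⟨a, u⟩
      · left; rfl
      · right
        simp only [Finset.mem_biUnion, Finset.mem_univ, true_and, Finset.mem_map, consEmb_apply] at hv ⊢
        obtain ⟨i, w, hw, rfl⟩ := hv
        rw [List.cons_prefix_cons] at huv
        exact ⟨i, u, (ts i).prefix_closed _ _ huv.2 hw, by rw [huv.1]⟩
  labels_pos := by
    intro u hu
    rw [Finset.mem_insert] at hu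
    rcases hu with rfl | hu
    · simp
    · simp only [Finset.mem_biUnion, Finset.mem_univ, true_and, Finset.mem_map, consEmb_apply] at hu
      obtain ⟨i, w, hw, rfl⟩ := hu
      intro k hk
      rw [List.mem_cons] at hk
      rcases hk with rfl | hk
      · omega
      · exact (ts i).labels_pos w hw k hk
  children_closed := by
    intro u i hi hu
    rw [Finset.mem_insert] at hu ⊢
    rcases hu with hu | hu
    · simp at hu
    · right
      simp only [Finset.mem_biUnion, Finset.mem_univ, true_and, Finset.mem_map, consEmb_apply] at hu ⊢
      obtain ⟨a, w, hw, h⟩ := hu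
      rcases u with _ | ⟨b, u⟩
      · simp only [List.nil_append, List.cons.injEq] at h
        refine ⟨⟨i - 1, by omega⟩, [], (ts _).root_mem, ?_⟩
        simp; omega
      · simp only [List.cons_append, List.cons.injEq] at h
        refine ⟨a, u ++ [i], (ts a).children_closed u i hi (h.2 ▸ hw), ?_⟩
        simp [h.1]

theorem mem_graft_cons {j : ℕ} {ts : Fin j → PlaneTree} {a : ℕ} {u : List ℕ} :
    a :: u ∈ (graft j ts).verts ↔ ∃ i : Fin j, a = i + 1 ∧ u ∈ (ts i).verts := by
  simp only [graft, Finset.mem_insert, Finset.mem_biUnion, Finset.mem_univ, true_and,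
    Finset.mem_map, consEmb_apply]
  constructor
  · rintro (h | ⟨i, w, hw, h⟩)
    · simp at h
    · simp only [List.cons.injEq] at h
      exact ⟨i, h.1.symm, h.2 ▸ hw⟩
  · rintro ⟨i, h, hu⟩
    exact Or.inr ⟨i, u, hu, by rw [h]⟩

theorem mem_graft_cons' {j : ℕ} {ts : Fin j → PlaneTree} (i : Fin j) {u : List ℕ} :
    (i + 1 : ℕ) :: u ∈ (graft j ts).verts ↔ u ∈ (ts i).verts := by
  rw [mem_graft_cons]
  constructor
  · rintro ⟨k, h, hu⟩
    have : i = k := by ext; omega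
    rwa [this]
  · intro h; exact ⟨i, rfl, h⟩

theorem kc_graft_root {j : ℕ} (ts : Fin j → PlaneTree) : (graft j ts).kc [] = j := by
  unfold kc
  have : {i : ℕ | [] ++ [i] ∈ (graft j ts).verts} = ((Finset.Icc 1 j : Finset ℕ) : Set ℕ) := by
    ext i
    simp only [List.nil_append, Set.mem_ofPred_eq, mem_graft_cons, Finset.coe_Icc, Set.mem_Icc]
    constructor
    · rintro ⟨k, rfl, -⟩; omega
    · rintro ⟨h1, h2⟩
      exact ⟨⟨i - 1, by omega⟩, by simp; omega, (ts _).root_mem⟩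
  rw [this, Set.ncard_coe_finset]; simp

theorem kc_graft_cons {j : ℕ} (ts : Fin j → PlaneTree) (i : Fin j) (u : List ℕ) :
    (graft j ts).kc ((i + 1 : ℕ) :: u) = (ts i).kc u := by
  unfold kc
  congr 1
  ext k
  simp only [List.cons_append, Set.mem_ofPred_eq, mem_graft_cons']

theorem graft_disj {j : ℕ} (ts : Fin j → PlaneTree) :
    Set.PairwiseDisjoint (↑(Finset.univ : Finset (Fin j)))
      (fun i : Fin j => (ts i).verts.map (consEmb (i + 1))) := by
  intro a _ b _ hab
  rw [Function.onFun, Finset.disjoint_left]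
  intro u hu hu'
  simp only [Finset.mem_map, consEmb_apply] at hu hu'
  obtain ⟨w, _, rfl⟩ := hu
  obtain ⟨w', _, h⟩ := hu'
  simp only [List.cons.injEq] at h
  apply hab; ext; omega

theorem graft_root_notMem {j : ℕ} (ts : Fin j → PlaneTree) :
    [] ∉ Finset.univ.biUnion fun i : Fin j => (ts i).verts.map (consEmb (i + 1)) := by
  simp

theorem card_graft {j : ℕ} (ts : Fin j → PlaneTree) :
    (graft j ts).verts.card = 1 + ∑ i, (ts i).verts.card := by
  change (insert [] _ : Finset (List ℕ)).card = _
  rw [Finset.card_insert_of_notMem (graft_root_notMem ts), Finset.card_biUnion (graft_disj ts)]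
  simp [add_comm]

theorem subtreeSize_graft {j : ℕ} (ts : Fin j → PlaneTree) (i : Fin j) :
    (graft j ts).subtreeSize [(i + 1 : ℕ)] = (ts i).verts.card := by
  unfold subtreeSize
  have : {v : List ℕ | v ∈ (graft j ts).verts ∧ [(i + 1 : ℕ)] <+: v} =
      (((ts i).verts.map (consEmb (i + 1)) : Finset (List ℕ)) : Set (List ℕ)) := by
    ext v
    rcases v with _ | ⟨a, v⟩
    · simp
    · simp only [Set.mem_ofPred_eq, List.cons_prefix_cons, List.nil_prefix, and_true,
        Finset.coe_map, consEmb_apply, Set.mem_image, Finset.mem_coe,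
        List.cons.injEq]
      constructor
      · rintro ⟨h, rfl⟩
        exact ⟨v, (mem_graft_cons' i).1 h, rfl, rfl⟩
      · rintro ⟨w, hw, rfl, rfl⟩
        exact ⟨(mem_graft_cons' i).2 hw, rfl⟩
  rw [this, Set.ncard_coe_finset]; simp

theorem bgwModW_graft (μ0 μ : ℕ → ℝ) {j : ℕ} (ts : Fin j → PlaneTree) :
    bgwModW μ0 μ (graft j ts) = μ0 j * ∏ i, bgwW μ (ts i) := by
  unfold bgwModW bgwW
  rw [kc_graft_root]
  congr 1
  have : (graft j ts).verts.erase [] =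
      Finset.univ.biUnion fun i : Fin j => (ts i).verts.map (consEmb (i + 1)) :=
    Finset.erase_insert (graft_root_notMem ts)
  rw [this, Finset.prod_biUnion (graft_disj ts)]
  refine Finset.prod_congr rfl fun i _ => ?_
  rw [Finset.prod_map]
  refine Finset.prod_congr rfl fun u _ => ?_
  rw [show consEmb (i + 1) u = (i + 1 : ℕ) :: u from rfl, kc_graft_cons]

theorem bgwModW_self (μ : ℕ → ℝ) (τ : PlaneTree) : bgwModW μ μ τ = bgwW μ τ := by
  unfold bgwModW bgwW
  exact Finset.mul_prod_erase τ.verts (fun u => μ (τ.kc u)) τ.root_mem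

theorem graft_injective {j : ℕ} {ts ts' : Fin j → PlaneTree} (h : graft j ts = graft j ts') :
    ts = ts' := by
  funext i
  apply ext'
  ext u
  rw [← mem_graft_cons' i, ← mem_graft_cons' (ts := ts') i, h]

/-- The subtree above a child of the root, re-rooted. -/
def sub (τ : PlaneTree) (i : ℕ) (hi : [i] ∈ τ.verts) : PlaneTree where
  verts := τ.verts.preimage (consEmb i) (consEmb i).injective.injOn
  root_mem := by simpa using hi
  prefix_closed := by
    intro u v huv hv
    simp only [Finset.mem_preimage, consEmb_apply] at hv ⊢
    exact τ.prefix_closed _ _ (List.cons_prefix_cons.2 ⟨rfl, huv⟩) hv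
  labels_pos := by
    intro u hu k hk
    simp only [Finset.mem_preimage, consEmb_apply] at hu
    exact τ.labels_pos _ hu k (List.mem_cons_of_mem _ hk)
  children_closed := by
    intro u k hk hu
    simp only [Finset.mem_preimage, consEmb_apply] at hu ⊢
    exact τ.children_closed (i :: u) k hk hu

theorem mem_sub {τ : PlaneTree} {i : ℕ} {hi : [i] ∈ τ.verts} {u : List ℕ} :
    u ∈ (τ.sub i hi).verts ↔ i :: u ∈ τ.verts := by
  simp [sub]

theorem mem_child_iff (τ : PlaneTree) (i : ℕ) : [i] ∈ τ.verts ↔ 1 ≤ i ∧ i ≤ τ.kc [] := by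
  have hfin : {i : ℕ | [i] ∈ τ.verts}.Finite := by
    have : {i : ℕ | [i] ∈ τ.verts} = (fun i : ℕ => [i]) ⁻¹' (τ.verts : Set (List ℕ)) := rfl
    rw [this]
    exact Set.Finite.preimage (fun a _ b _ h => by simpa using h) (Finset.finite_toSet _)
  have hdown : ∀ d i : ℕ, 1 ≤ i → [i + d] ∈ τ.verts → [i] ∈ τ.verts := by
    intro d
    induction d with
    | zero => intro i _ h; simpa using h
    | succ d ih =>
      intro i hi h
      exact ih i hi (τ.children_closed [] (i + d) (by omega) h)
  have hpos : ∀ i, [i] ∈ τ.verts → 1 ≤ i := fun i hi => τ.labels_pos _ hi i (by simp)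
  have hkc : τ.kc [] = {i : ℕ | [i] ∈ τ.verts}.ncard := rfl
  constructor
  · intro h
    refine ⟨hpos i h, ?_⟩
    rw [hkc]
    have hsub : ((Finset.Icc 1 i : Finset ℕ) : Set ℕ) ⊆ {i : ℕ | [i] ∈ τ.verts} := by
      intro k hk
      simp only [Finset.coe_Icc, Set.mem_Icc] at hk
      exact hdown (i - k) k hk.1 (by rw [Nat.add_sub_cancel' hk.2]; exact h)
    have := Set.ncard_le_ncard hsub hfin
    rw [Set.ncard_coe_finset] at this
    simpa using this
  · rintro ⟨h1, h2⟩
    by_contra hcon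
    have hsub : {i : ℕ | [i] ∈ τ.verts} ⊆ ((Finset.Icc 1 (i - 1) : Finset ℕ) : Set ℕ) := by
      intro k hk
      simp only [Finset.coe_Icc, Set.mem_Icc]
      refine ⟨hpos k hk, ?_⟩
      by_contra hlt
      exact hcon (hdown (k - i) i h1 (by rw [Nat.add_sub_cancel' (by omega)]; exact hk))
    have := Set.ncard_le_ncard hsub (Finset.finite_toSet _)
    rw [Set.ncard_coe_finset, ← hkc] at this
    simp at this; omega

theorem exists_graft (τ : PlaneTree) : ∃ ts : Fin (τ.kc []) → PlaneTree, graft (τ.kc []) ts = τ := by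
  refine ⟨fun i => τ.sub (i + 1) ((τ.mem_child_iff _).2 ⟨by omega, by omega⟩), ?_⟩
  apply ext'
  ext u
  rcases u with _ | ⟨a, u⟩
  · simp [root_mem]
  · rw [mem_graft_cons]
    constructor
    · rintro ⟨i, rfl, hu⟩
      exact mem_sub.1 hu
    · intro h
      have ha : [a] ∈ τ.verts := τ.prefix_closed _ _ (by simp) h
      rw [mem_child_iff] at ha
      refine ⟨⟨a - 1, by omega⟩, by simp; omega, ?_⟩
      rw [mem_sub]
      simpa [Nat.sub_add_cancel ha.1] using h

theorem card_pos (τ : PlaneTree) : 0 < τ.verts.card := Finset.card_pos.2 ⟨_, τ.root_mem⟩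

theorem finite_card_le (n : ℕ) : {τ : PlaneTree | τ.verts.card ≤ n}.Finite := by
  induction n with
  | zero =>
    convert Set.finite_empty
    ext τ
    have := τ.card_pos
    simp only [Set.mem_ofPred_eq, Set.mem_empty_iff_false, iff_false]; omega
  | succ n ih =>
    have : Finite {τ : PlaneTree | τ.verts.card ≤ n} := ih
    refine Set.Finite.subset (Set.finite_range
      (fun x : (Σ j : Fin (n + 1), (Fin j → {τ : PlaneTree | τ.verts.card ≤ n})) =>
        graft x.1 (fun i => (x.2 i).1))) ?_
    intro τ hτ
    simp only [Set.mem_ofPred_eq] at hτ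
    obtain ⟨ts, hts⟩ := τ.exists_graft
    have hc := card_graft ts
    rw [hts] at hc
    have h1 : τ.kc [] ≤ ∑ i, (ts i).verts.card := by
      calc τ.kc [] = ∑ i : Fin (τ.kc []), 1 := by simp
        _ ≤ _ := Finset.sum_le_sum fun i _ => (ts i).card_pos
    refine ⟨⟨⟨τ.kc [], by omega⟩, fun i => ⟨ts i, ?_⟩⟩, hts⟩
    have := Finset.single_le_sum (f := fun i => (ts i).verts.card) (fun i _ => Nat.zero_le _)
      (Finset.mem_univ i)
    simp only [Set.mem_ofPred_eq]; simp only at this; omega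

/-- All plane trees with at most `n` vertices. -/
def allLe (n : ℕ) : Finset PlaneTree := (finite_card_le n).toFinset

theorem mem_allLe {n : ℕ} {τ : PlaneTree} : τ ∈ allLe n ↔ τ.verts.card ≤ n := by
  simp [allLe]

end PlaneTree

open PlaneTree in
/-- The law of the total size. -/
def qsz (μ : ℕ → ℝ) (n : ℕ) : ℝ := ∑ τ ∈ allLe n with τ.verts.card = n, bgwW μ τ

theorem coeff_pow_congr {f g : PowerSeries ℝ} {n : ℕ}
    (h : ∀ m ≤ n, PowerSeries.coeff m f = PowerSeries.coeff m g) (j : ℕ) :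
    ∀ m ≤ n, PowerSeries.coeff m (f ^ j) = PowerSeries.coeff m (g ^ j) := by
  induction j with
  | zero => intros; simp
  | succ j ih =>
    intro m hm
    rw [pow_succ, pow_succ, PowerSeries.coeff_mul, PowerSeries.coeff_mul]
    refine Finset.sum_congr rfl fun p hp => ?_
    rw [Finset.HasAntidiagonal.mem_antidiagonal] at hp
    rw [ih p.1 (by omega), h p.2 (by omega)]

open Classical in
/-- Generating function of the sizes satisfying `p`. -/
def genQ (μ : ℕ → ℝ) (p : ℕ → Prop) : PowerSeries ℝ :=
  PowerSeries.mk fun l => if p l then qsz μ l else 0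

open Classical PlaneTree in
theorem tuple_sum (μ : ℕ → ℝ) (p : ℕ → Prop) (j n m : ℕ) (hm : m ≤ n) :
    ∑ ts ∈ Fintype.piFinset (fun _ : Fin j => allLe n),
      (if (∑ i, (ts i).verts.card = m ∧ ∀ i, p (ts i).verts.card) then ∏ i, bgwW μ (ts i) else 0)
    = PowerSeries.coeff m ((genQ μ p) ^ j) := by
  set T' : PowerSeries ℝ := ∑ τ ∈ allLe n,
    PowerSeries.monomial τ.verts.card (if p τ.verts.card then bgwW μ τ else 0) with hT'
  have hco : ∀ l ≤ n, PowerSeries.coeff l (genQ μ p) = PowerSeries.coeff l T' := by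
    intro l hl
    rw [hT', map_sum, genQ, PowerSeries.coeff_mk, qsz]
    simp only [PowerSeries.coeff_monomial]
    rw [← Finset.sum_filter]
    have e : (allLe l).filter (fun τ => τ.verts.card = l) =
        (allLe n).filter (fun τ => l = τ.verts.card) := by
      ext τ; simp only [Finset.mem_filter, mem_allLe]; omega
    rw [e]
    split_ifs with hp
    · refine Finset.sum_congr rfl fun τ hτ => ?_
      rw [Finset.mem_filter] at hτ
      rw [if_pos (hτ.2 ▸ hp)]
    · symm
      refine Finset.sum_eq_zero fun τ hτ => ?_
      rw [Finset.mem_filter] at hτ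
      rw [if_neg (hτ.2 ▸ hp)]
  rw [coeff_pow_congr hco j m hm]
  have hpow : T' ^ j = ∏ _i : Fin j, T' := by simp
  rw [hpow, hT', Finset.prod_univ_sum, map_sum]
  refine Finset.sum_congr rfl fun ts _ => ?_
  have hprod : ∀ s : Finset (Fin j), ∏ i ∈ s, PowerSeries.monomial (ts i).verts.card
      (if p (ts i).verts.card then bgwW μ (ts i) else 0) =
      PowerSeries.monomial (∑ i ∈ s, (ts i).verts.card)
        (∏ i ∈ s, if p (ts i).verts.card then bgwW μ (ts i) else 0) := by
    intro s
    induction s using Finset.induction_on with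
    | empty => simp
    | insert a s ha ih =>
      rw [Finset.prod_insert ha, Finset.sum_insert ha, Finset.prod_insert ha, ih,
        PowerSeries.monomial_mul_monomial]
  rw [hprod, PowerSeries.coeff_monomial]
  by_cases h1 : ∑ i, (ts i).verts.card = m
  · rw [if_pos h1.symm]
    by_cases h2 : ∀ i, p (ts i).verts.card
    · rw [if_pos ⟨h1, h2⟩]
      exact Finset.prod_congr rfl fun i _ => by rw [if_pos (h2 i)]
    · rw [if_neg (fun h => h2 h.2)]
      push Not at h2
      obtain ⟨i, hi⟩ := h2
      symm
      exact Finset.prod_eq_zero (Finset.mem_univ i) (if_neg hi)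
  · rw [if_neg (fun h => h1 h.1), if_neg (fun h => h1 h.symm)]

open Classical PlaneTree in
theorem root_decomp (μ0 μ : ℕ → ℝ) (p : ℕ → Prop) (n : ℕ) :
    ∑ᶠ τ ∈ {τ : PlaneTree | τ.verts.card = n + 1 ∧
        ∀ i ∈ Finset.Icc 1 (τ.kc []), p (τ.subtreeSize [i])}, bgwModW μ0 μ τ
      = ∑ j ∈ Finset.range (n + 1), μ0 j * PowerSeries.coeff n ((genQ μ p) ^ j) := by
  have hset : {τ : PlaneTree | τ.verts.card = n + 1 ∧
        ∀ i ∈ Finset.Icc 1 (τ.kc []), p (τ.subtreeSize [i])} =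
      (((allLe (n + 1)).filter fun τ => τ.verts.card = n + 1 ∧
        ∀ i ∈ Finset.Icc 1 (τ.kc []), p (τ.subtreeSize [i]) : Finset PlaneTree) :
          Set PlaneTree) := by
    ext τ
    simp only [Set.mem_ofPred_eq, Finset.coe_filter, mem_allLe]
    constructor
    · intro h; exact ⟨h.1.le, h⟩
    · intro h; exact h.2
  rw [hset, finsum_mem_coe_finset]
  simp_rw [← tuple_sum μ p _ n n le_rfl, ← Finset.sum_filter, Finset.mul_sum]
  rw [Finset.sum_sigma']
  symm
  refine Finset.sum_bij (fun x _ => graft x.1 x.2) ?_ ?_ ?_ ?_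
  · rintro ⟨j, ts⟩ h
    simp only [Finset.mem_sigma, Finset.mem_range, Finset.mem_filter, Fintype.mem_piFinset,
      mem_allLe] at h ⊢
    rw [card_graft, kc_graft_root]
    refine ⟨by omega, by omega, ?_⟩
    intro i hi
    rw [Finset.mem_Icc] at hi
    obtain ⟨k, rfl⟩ : ∃ k : Fin j, i = k + 1 := ⟨⟨i - 1, by omega⟩, by simp; omega⟩
    rw [subtreeSize_graft]
    exact h.2.2.2 k
  · rintro ⟨j, ts⟩ _ ⟨j', ts'⟩ _ h
    simp only at h
    have : j = j' := by rw [← kc_graft_root ts, h, kc_graft_root]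
    subst this
    rw [graft_injective h]
  · intro τ hτ
    simp only [Finset.mem_filter, mem_allLe] at hτ
    obtain ⟨ts, hts⟩ := τ.exists_graft
    have hc := card_graft ts
    rw [hts] at hc
    have h1 : τ.kc [] ≤ ∑ i, (ts i).verts.card := by
      calc τ.kc [] = ∑ i : Fin (τ.kc []), 1 := by simp
        _ ≤ _ := Finset.sum_le_sum fun i _ => (ts i).card_pos
    refine ⟨⟨τ.kc [], ts⟩, ?_, hts⟩
    simp only [Finset.mem_sigma, Finset.mem_range, Finset.mem_filter, Fintype.mem_piFinset,
      mem_allLe]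
    refine ⟨by omega, fun i => ?_, by omega, fun i => ?_⟩
    · have := Finset.single_le_sum (f := fun i => (ts i).verts.card) (fun i _ => Nat.zero_le _)
        (Finset.mem_univ i)
      omega
    · have := hτ.2.2 (i + 1) (by rw [Finset.mem_Icc]; omega)
      have h3 := subtreeSize_graft ts i
      rw [hts] at h3
      rwa [h3] at this
  · rintro ⟨j, ts⟩ _
    rw [bgwModW_graft]

theorem qsz_zero (μ : ℕ → ℝ) : qsz μ 0 = 0 := by
  unfold qsz
  refine Finset.sum_eq_zero fun τ hτ => ?_
  have := τ.card_pos
  rw [Finset.mem_filter] at hτ; omega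

theorem qsz_nonneg {μ : ℕ → ℝ} (hμ : ∀ j, 0 ≤ μ j) (n : ℕ) : 0 ≤ qsz μ n :=
  Finset.sum_nonneg fun _ _ => Finset.prod_nonneg fun _ _ => hμ _

theorem bgwModMass_eq (μ0 μ : ℕ → ℝ) (n : ℕ) : bgwModMass μ0 μ (n + 1) =
    ∑ j ∈ Finset.range (n + 1), μ0 j * PowerSeries.coeff n ((genQ μ fun _ => True) ^ j) := by
  rw [← root_decomp]
  simp [bgwModMass]

open PlaneTree in
theorem qsz_succ (μ : ℕ → ℝ) (n : ℕ) : qsz μ (n + 1) =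
    ∑ j ∈ Finset.range (n + 1), μ j * PowerSeries.coeff n ((genQ μ fun _ => True) ^ j) := by
  rw [← bgwModMass_eq, bgwModMass, qsz]
  have hset : {τ : PlaneTree | τ.verts.card = n + 1} =
      (((allLe (n + 1)).filter fun τ => τ.verts.card = n + 1 : Finset PlaneTree) :
          Set PlaneTree) := by
    ext τ
    simp only [Set.mem_ofPred_eq, Finset.coe_filter, mem_allLe]
    constructor
    · intro h; exact ⟨h.le, h⟩
    · intro h; exact h.2
  rw [hset, finsum_mem_coe_finset]
  exact Finset.sum_congr rfl fun τ _ => (bgwModW_self μ τ).symm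

open PlaneTree in
theorem numerator_le (μ0 μ : ℕ → ℝ) (h0 : ∀ j, 0 ≤ μ0 j) (hμ : ∀ j, 0 ≤ μ j) (n : ℕ) (x : ℝ) :
    ∑ᶠ τ ∈ {τ : PlaneTree | τ.verts.card = n + 1 ∧ (τ.maxSub : ℝ) ≤ x}, bgwModW μ0 μ τ ≤
    ∑ j ∈ Finset.range (n + 1), μ0 j *
      PowerSeries.coeff n ((genQ μ fun l => (l : ℝ) ≤ x) ^ j) := by
  rw [← root_decomp]
  have hw : ∀ τ, 0 ≤ bgwModW μ0 μ τ := fun τ =>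
    mul_nonneg (h0 _) (Finset.prod_nonneg fun _ _ => hμ _)
  have hsub : {τ : PlaneTree | τ.verts.card = n + 1 ∧ (τ.maxSub : ℝ) ≤ x} ⊆
      {τ : PlaneTree | τ.verts.card = n + 1 ∧
        ∀ i ∈ Finset.Icc 1 (τ.kc []), ((τ.subtreeSize [i] : ℕ) : ℝ) ≤ x} := by
    rintro τ ⟨h1, h2⟩
    refine ⟨h1, fun i hi => le_trans ?_ h2⟩
    exact_mod_cast Finset.le_sup (f := fun i => τ.subtreeSize [i]) hi
  have hfin : {τ : PlaneTree | τ.verts.card = n + 1 ∧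
        ∀ i ∈ Finset.Icc 1 (τ.kc []), ((τ.subtreeSize [i] : ℕ) : ℝ) ≤ x}.Finite :=
    (finite_card_le (n + 1)).subset fun τ h => h.1.le
  rw [finsum_mem_eq_finite_toFinset_sum _ hfin,
    finsum_mem_eq_finite_toFinset_sum _ (hfin.subset hsub)]
  exact Finset.sum_le_sum_of_subset_of_nonneg (Set.Finite.toFinset_subset_toFinset.2 hsub)
    fun τ _ _ => hw τ


/-! ### Kemperman's formula -/

/-- Offspring generating series. -/
def genF (μ : ℕ → ℝ) : PowerSeries ℝ := PowerSeries.mk μ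

/-- Generating series of the total size. -/
def genT (μ : ℕ → ℝ) : PowerSeries ℝ := genQ μ fun _ => True

theorem coeff_genT (μ : ℕ → ℝ) (n : ℕ) : PowerSeries.coeff n (genT μ) = qsz μ n := by
  simp [genT, genQ]

theorem coeff_genT_pow_of_lt (μ : ℕ → ℝ) (j : ℕ) :
    ∀ n, n < j → PowerSeries.coeff n (genT μ ^ j) = 0 := by
  induction j with
  | zero => intro n h; omega
  | succ j ih =>
    intro n h
    rw [pow_succ, PowerSeries.coeff_mul]
    refine Finset.sum_eq_zero fun p hp => ?_
    rw [Finset.HasAntidiagonal.mem_antidiagonal] at hp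
    by_cases h1 : p.1 < j
    · rw [ih _ h1, zero_mul]
    · have : p.2 = 0 := by omega
      rw [this, coeff_genT, qsz_zero, mul_zero]

theorem forest_rec (μ : ℕ → ℝ) (j n : ℕ) :
    PowerSeries.coeff (n + 1) (genT μ ^ (j + 1)) =
      ∑ k ∈ Finset.range (n + 1), μ k * PowerSeries.coeff n (genT μ ^ (j + k)) := by
  have hq : ∀ m ≤ n, qsz μ (m + 1) =
      ∑ k ∈ Finset.range (n + 1), μ k * PowerSeries.coeff m (genT μ ^ k) := by
    intro m hm
    rw [qsz_succ]
    refine Finset.sum_subset (by intro x; simp; omega) ?_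
    intro k _ hk
    rw [Finset.mem_range] at hk
    change μ k * PowerSeries.coeff m (genT μ ^ k) = 0
    rw [coeff_genT_pow_of_lt _ _ _ (by omega), mul_zero]
  rw [pow_succ', PowerSeries.coeff_mul, Finset.Nat.antidiagonal_succ, Finset.sum_cons]
  simp only [coeff_genT, qsz_zero, zero_mul, zero_add, Finset.sum_map]
  simp_rw [pow_add, PowerSeries.coeff_mul]
  have : ∀ x ∈ Finset.HasAntidiagonal.antidiagonal n,
      qsz μ (x.1 + 1) * PowerSeries.coeff x.2 (genT μ ^ j) =
      ∑ k ∈ Finset.range (n + 1), μ k * (PowerSeries.coeff x.1 (genT μ ^ k) *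
        PowerSeries.coeff x.2 (genT μ ^ j)) := by
    intro x hx
    rw [Finset.HasAntidiagonal.mem_antidiagonal] at hx
    rw [hq x.1 (by omega), Finset.sum_mul]
    exact Finset.sum_congr rfl fun k _ => by ring
  have h2 := Finset.sum_congr rfl this
  refine Eq.trans h2 ?_
  rw [Finset.sum_comm]
  refine Finset.sum_congr rfl fun k _ => ?_
  rw [← Finset.mul_sum, ← PowerSeries.coeff_mul, ← PowerSeries.coeff_mul, mul_comm (genT μ ^ k)]

theorem kemperman (μ : ℕ → ℝ) (n : ℕ) : ∀ j ≤ n,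
    (n : ℝ) * PowerSeries.coeff n (genT μ ^ j) = j * PowerSeries.coeff (n - j) (genF μ ^ n) := by
  induction n with
  | zero => intro j hj; simp [Nat.le_zero.1 hj]
  | succ n ih =>
    intro j hj
    rcases j with _ | j
    · simp [PowerSeries.coeff_one]
    rw [forest_rec]
    rcases n with _ | n
    · have : j = 0 := by omega
      subst this
      simp [genF]
    set N := n + 1 with hN
    set m := N - j with hm
    have hj' : j ≤ N := by omega
    have e1 : (N : ℝ) * ∑ k ∈ Finset.range (N + 1), μ k * PowerSeries.coeff N (genT μ ^ (j + k)) =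
        ∑ k ∈ Finset.range (m + 1), μ k * (j + k) * PowerSeries.coeff (m - k) (genF μ ^ N) := by
      rw [Finset.mul_sum]
      symm
      have hsub : Finset.range (m + 1) ⊆ Finset.range (N + 1) := by
        intro x; simp only [Finset.mem_range]; omega
      rw [← Finset.sum_subset hsub (f := fun k =>
        (N : ℝ) * (μ k * PowerSeries.coeff N (genT μ ^ (j + k))))]
      · refine Finset.sum_congr rfl fun k hk => ?_
        rw [Finset.mem_range] at hk
        have := ih (j + k) (by omega)
        rw [show N - (j + k) = m - k by omega] at this
        rw [mul_left_comm, this]; push_cast; ring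
      · intro k _ hk
        rw [Finset.mem_range] at hk
        rw [coeff_genT_pow_of_lt _ _ _ (by omega)]; simp
    have e2 : ∑ k ∈ Finset.range (m + 1), μ k * (j + k) * PowerSeries.coeff (m - k) (genF μ ^ N)
        = j * PowerSeries.coeff m (genF μ ^ (N + 1)) +
          PowerSeries.coeff m (PowerSeries.mk (fun k => (k : ℝ) * μ k) * genF μ ^ N) := by
      rw [pow_succ' (genF μ) N, PowerSeries.coeff_mul, PowerSeries.coeff_mul,
        Finset.Nat.sum_antidiagonal_eq_sum_range_succ_mk,
        Finset.Nat.sum_antidiagonal_eq_sum_range_succ_mk, Finset.mul_sum, ← Finset.sum_add_distrib]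
      refine Finset.sum_congr rfl fun k _ => ?_
      simp only [genF, PowerSeries.coeff_mk]; ring
    have e3 : ((N : ℝ) + 1) * PowerSeries.coeff m
        (PowerSeries.mk (fun k => (k : ℝ) * μ k) * genF μ ^ N) =
        m * PowerSeries.coeff m (genF μ ^ (N + 1)) := by
      have hX : ∀ (F : PowerSeries ℝ) (k : ℕ), PowerSeries.coeff k
          (PowerSeries.X * PowerSeries.derivative ℝ F) = k * PowerSeries.coeff k F := by
        intro F k
        rcases k with _ | k
        · simp
        · rw [PowerSeries.coeff_succ_X_mul, PowerSeries.coeff_derivative]; push_cast; ring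
      have hG : PowerSeries.mk (fun k => (k : ℝ) * μ k) =
          PowerSeries.X * PowerSeries.derivative ℝ (genF μ) := by
        ext k; rw [hX]; simp [genF]
      rw [← hX, Derivation.leibniz_pow, hG, Nat.add_sub_cancel, smul_eq_mul, nsmul_eq_mul,
        show PowerSeries.X * (((N + 1 : ℕ) : PowerSeries ℝ) *
          (genF μ ^ N * PowerSeries.derivative ℝ (genF μ))) =
          (N + 1) • (PowerSeries.X * PowerSeries.derivative ℝ (genF μ) * genF μ ^ N) by
          rw [nsmul_eq_mul]; ring, map_nsmul, nsmul_eq_mul]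
      push_cast; ring
    rw [show N + 1 - (j + 1) = m by omega]
    have hN0 : (N : ℝ) ≠ 0 := by positivity
    have hmr : (m : ℝ) = N - j := by rw [hm, Nat.cast_sub hj']
    rw [← mul_right_inj' hN0]
    push_cast
    rw [mul_left_comm, e1, e2, mul_add, e3, hmr]
    ring

theorem coeff_pow_nonneg {f : PowerSeries ℝ} (h : ∀ n, 0 ≤ PowerSeries.coeff n f) (j : ℕ) :
    ∀ n, 0 ≤ PowerSeries.coeff n (f ^ j) := by
  induction j with
  | zero => intro n; rw [pow_zero, PowerSeries.coeff_one]; split_ifs <;> norm_num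
  | succ j ih =>
    intro n
    rw [pow_succ, PowerSeries.coeff_mul]
    exact Finset.sum_nonneg fun p _ => mul_nonneg (ih _) (h _)

theorem coeff_pow_mono {f g : PowerSeries ℝ} (h : ∀ n, 0 ≤ PowerSeries.coeff n f)
    (hfg : ∀ n, PowerSeries.coeff n f ≤ PowerSeries.coeff n g) (j : ℕ) :
    ∀ n, PowerSeries.coeff n (f ^ j) ≤ PowerSeries.coeff n (g ^ j) := by
  induction j with
  | zero => intro n; simp
  | succ j ih =>
    intro n
    rw [pow_succ, pow_succ, PowerSeries.coeff_mul, PowerSeries.coeff_mul]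
    exact Finset.sum_le_sum fun p _ => mul_le_mul (ih _) (hfg _) (h _)
      ((coeff_pow_nonneg h j _).trans (ih _))


/-! ### Fourier inversion -/

/-- Characteristic function of the offspring law. -/
def phi (μ : ℕ → ℝ) (t : ℝ) : ℂ := ∑' k : ℕ, (μ k : ℂ) * Complex.exp (Complex.I * ((t * k : ℝ) : ℂ))

/-- Characteristic function of the centred offspring law. -/
def psi (μ : ℕ → ℝ) (t : ℝ) : ℂ := phi μ t * Complex.exp (-(Complex.I * (t : ℂ)))

theorem norm_expI (x : ℝ) : ‖Complex.exp (Complex.I * (x : ℂ))‖ = 1 := by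
  rw [mul_comm]; exact Complex.norm_exp_ofReal_mul_I x

theorem norm_term {a : ℝ} (ha : 0 ≤ a) (x : ℝ) :
    ‖(a : ℂ) * Complex.exp (Complex.I * (x : ℂ))‖ = a := by
  rw [norm_mul, norm_expI, mul_one, Complex.norm_real, Real.norm_of_nonneg ha]

theorem phi_pow {μ : ℕ → ℝ} (hnn : ∀ j, 0 ≤ μ j) (hs : Summable μ) (n : ℕ) :
    Summable (fun m => PowerSeries.coeff m (genF μ ^ n)) ∧
    ∀ t : ℝ, HasSum (fun m : ℕ => ((PowerSeries.coeff m (genF μ ^ n) : ℝ) : ℂ) *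
      Complex.exp (Complex.I * ((t * m : ℝ) : ℂ))) (phi μ t ^ n) := by
  have hcn : ∀ n m, 0 ≤ PowerSeries.coeff m (genF μ ^ n) := fun n m =>
    coeff_pow_nonneg (f := genF μ) (fun k => by simpa [genF] using hnn k) n m
  induction n with
  | zero =>
    refine ⟨?_, fun t => ?_⟩
    · refine summable_of_ne_finset_zero (s := {0}) ?_
      intro b hb
      simp only [Finset.mem_singleton] at hb
      simp [PowerSeries.coeff_one, hb]
    · have hfun : (fun m : ℕ => ((PowerSeries.coeff m (genF μ ^ 0) : ℝ) : ℂ) *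
          Complex.exp (Complex.I * ((t * m : ℝ) : ℂ))) = fun m => if m = 0 then (1 : ℂ) else 0 := by
        funext m
        rw [pow_zero, PowerSeries.coeff_one]
        split_ifs with h <;> simp [h]
      rw [hfun, pow_zero]
      exact hasSum_ite_eq (0 : ℕ) (1 : ℂ)
  | succ n ih =>
    have hco : ∀ m, PowerSeries.coeff m (genF μ ^ (n + 1)) =
        ∑ p ∈ Finset.HasAntidiagonal.antidiagonal m,
          PowerSeries.coeff p.1 (genF μ ^ n) * μ p.2 := by
      intro m
      rw [pow_succ, PowerSeries.coeff_mul]; simp [genF]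
    constructor
    · have h1 : Summable fun m => ‖PowerSeries.coeff m (genF μ ^ n)‖ := ih.1.norm
      have h2 : Summable fun m => ‖μ m‖ := hs.norm
      have := (summable_norm_sum_mul_antidiagonal_of_summable_norm h1 h2).of_norm
      simpa only [hco] using this
    · intro t
      have h1 : Summable fun m : ℕ => ‖((PowerSeries.coeff m (genF μ ^ n) : ℝ) : ℂ) *
          Complex.exp (Complex.I * ((t * m : ℝ) : ℂ))‖ := by
        simpa only [norm_term (hcn _ _)] using ih.1
      have h2 : Summable fun m : ℕ => ‖(μ m : ℂ) *
          Complex.exp (Complex.I * ((t * m : ℝ) : ℂ))‖ := by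
        simpa only [norm_term (hnn _)] using hs
      have h3 := (summable_norm_sum_mul_antidiagonal_of_summable_norm h1 h2).of_norm.hasSum
      rw [← tsum_mul_tsum_eq_tsum_sum_antidiagonal_of_summable_norm h1 h2, (ih.2 t).tsum_eq,
        ← phi, ← pow_succ] at h3
      refine Eq.mp (congrArg (fun f : ℕ → ℂ => HasSum f (phi μ t ^ (n + 1))) (funext fun m => ?_)) h3
      symm
      rw [hco, Complex.ofReal_sum, Finset.sum_mul]
      refine Finset.sum_congr rfl fun p hp => ?_
      rw [Finset.HasAntidiagonal.mem_antidiagonal] at hp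
      have : (m : ℝ) = p.1 + p.2 := by rw [← hp]; push_cast; ring
      rw [this]
      push_cast
      rw [mul_add (t : ℂ), mul_add Complex.I, Complex.exp_add]
      ring

theorem phi_continuous {μ : ℕ → ℝ} (hnn : ∀ j, 0 ≤ μ j) (hs : Summable μ) :
    Continuous (phi μ) := by
  refine continuous_tsum (u := μ) (fun k => by fun_prop) hs fun k t => ?_
  rw [norm_term (hnn k)]

theorem psi_continuous {μ : ℕ → ℝ} (hnn : ∀ j, 0 ≤ μ j) (hs : Summable μ) :
    Continuous (psi μ) := by
  have := phi_continuous hnn hs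
  unfold psi; fun_prop

theorem norm_psi (μ : ℕ → ℝ) (t : ℝ) : ‖psi μ t‖ = ‖phi μ t‖ := by
  rw [psi, norm_mul, show -(Complex.I * (t : ℂ)) = Complex.I * ((-t : ℝ) : ℂ) by push_cast; ring,
    norm_expI, mul_one]

theorem norm_phi_le {μ : ℕ → ℝ} (hnn : ∀ j, 0 ≤ μ j) (hs : HasSum μ 1) (t : ℝ) :
    ‖phi μ t‖ ≤ 1 := by
  have : Summable fun m : ℕ => ‖(μ m : ℂ) * Complex.exp (Complex.I * ((t * m : ℝ) : ℂ))‖ := by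
    simpa only [norm_term (hnn _)] using hs.summable
  refine (norm_tsum_le_tsum_norm this).trans ?_
  simp only [norm_term (hnn _)]
  exact hs.tsum_eq.le

theorem integral_expI (k m : ℕ) : ∫ t in (-Real.pi)..Real.pi,
    Complex.exp (Complex.I * ((t * k : ℝ) : ℂ)) * Complex.exp (-(Complex.I * ((t * m : ℝ) : ℂ))) =
    if k = m then (2 * Real.pi : ℂ) else 0 := by
  have e : ∀ t : ℝ, Complex.exp (Complex.I * ((t * k : ℝ) : ℂ)) *
      Complex.exp (-(Complex.I * ((t * m : ℝ) : ℂ))) =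
      Complex.exp ((Complex.I * ((k : ℂ) - m)) * t) := by
    intro t; rw [← Complex.exp_add]; congr 1; push_cast; ring
  simp_rw [e]
  split_ifs with h
  · subst h; simp; ring
  · have hne : Complex.I * ((k : ℂ) - m) ≠ 0 := by
      refine mul_ne_zero Complex.I_ne_zero (sub_ne_zero.2 ?_)
      exact_mod_cast h
    rw [integral_exp_mul_complex hne]
    have : Complex.exp (Complex.I * ((k : ℂ) - m) * (Real.pi : ℝ)) =
        Complex.exp (Complex.I * ((k : ℂ) - m) * ((-Real.pi : ℝ) : ℂ)) := by
      rw [Complex.exp_eq_exp_iff_exists_int]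
      refine ⟨(k : ℤ) - m, ?_⟩
      push_cast; ring
    rw [this, sub_self, zero_div]

theorem fourier_inv {μ : ℕ → ℝ} (hnn : ∀ j, 0 ≤ μ j) (hs : Summable μ) (n m : ℕ) :
    ∫ t in (-Real.pi)..Real.pi, phi μ t ^ n * Complex.exp (-(Complex.I * ((t * m : ℝ) : ℂ))) =
      2 * Real.pi * ((PowerSeries.coeff m (genF μ ^ n) : ℝ) : ℂ) := by
  obtain ⟨h1, h2⟩ := phi_pow hnn hs n
  have hcn : ∀ m, 0 ≤ PowerSeries.coeff m (genF μ ^ n) := fun m =>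
    coeff_pow_nonneg (f := genF μ) (fun k => by simpa [genF] using hnn k) n m
  have key := intervalIntegral.hasSum_integral_of_dominated_convergence
    (μ := MeasureTheory.volume) (a := -Real.pi) (b := Real.pi)
    (F := fun k t => ((PowerSeries.coeff k (genF μ ^ n) : ℝ) : ℂ) *
      Complex.exp (Complex.I * ((t * k : ℝ) : ℂ)) * Complex.exp (-(Complex.I * ((t * m : ℝ) : ℂ))))
    (f := fun t => phi μ t ^ n * Complex.exp (-(Complex.I * ((t * m : ℝ) : ℂ))))
    (fun k _ => PowerSeries.coeff k (genF μ ^ n))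
    (fun k => (by fun_prop : Continuous _).aestronglyMeasurable)
    (fun k => Filter.Eventually.of_forall fun t _ => by
      rw [norm_mul, norm_term (hcn _),
        show -(Complex.I * ((t * m : ℝ) : ℂ)) = Complex.I * ((-(t * m) : ℝ) : ℂ) by
          push_cast; ring, norm_expI, mul_one])
    (Filter.Eventually.of_forall fun t _ => h1)
    (by simp)
    (Filter.Eventually.of_forall fun t _ => (h2 t).mul_right _)
  have hterm : ∀ k, ∫ t in (-Real.pi)..Real.pi, ((PowerSeries.coeff k (genF μ ^ n) : ℝ) : ℂ) *
      Complex.exp (Complex.I * ((t * k : ℝ) : ℂ)) * Complex.exp (-(Complex.I * ((t * m : ℝ) : ℂ)))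
      = if k = m then 2 * Real.pi * ((PowerSeries.coeff m (genF μ ^ n) : ℝ) : ℂ) else 0 := by
    intro k
    simp_rw [mul_assoc]
    rw [intervalIntegral.integral_const_mul, integral_expI]
    split_ifs with h
    · rw [h]; ring
    · simp
  simp only [hterm] at key
  exact key.unique (hasSum_ite_eq m _)

theorem phi_neg (μ : ℕ → ℝ) (t : ℝ) : phi μ (-t) = (starRingEnd ℂ) (phi μ t) := by
  unfold phi
  rw [Complex.conj_tsum]
  refine tsum_congr fun k => ?_
  rw [map_mul, Complex.conj_ofReal, ← Complex.exp_conj, map_mul, Complex.conj_I,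
    Complex.conj_ofReal]
  push_cast; congr 2; ring

theorem coeff_eq_re {μ : ℕ → ℝ} (hnn : ∀ j, 0 ≤ μ j) (hs : Summable μ) (n m : ℕ) :
    PowerSeries.coeff m (genF μ ^ n) = (1 / Real.pi) * (∫ t in (0 : ℝ)..Real.pi,
      phi μ t ^ n * Complex.exp (-(Complex.I * ((t * m : ℝ) : ℂ)))).re := by
  set F : ℝ → ℂ := fun t => phi μ t ^ n * Complex.exp (-(Complex.I * ((t * m : ℝ) : ℂ))) with hF
  have hFc : Continuous F := by
    have := phi_continuous hnn hs
    simp only [hF]; fun_prop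
  have h := fourier_inv hnn hs n m
  have hneg : ∀ t, F (-t) = (starRingEnd ℂ) (F t) := by
    intro t
    simp only [hF]
    rw [phi_neg, map_mul, map_pow, ← Complex.exp_conj, map_neg, map_mul, Complex.conj_I,
      Complex.conj_ofReal]
    push_cast; congr 2; ring
  have hsplit : ∫ t in (-Real.pi)..Real.pi, F t =
      (starRingEnd ℂ) (∫ t in (0 : ℝ)..Real.pi, F t) + ∫ t in (0 : ℝ)..Real.pi, F t := by
    rw [← intervalIntegral.integral_add_adjacent_intervals (b := 0)
      (hFc.intervalIntegrable _ _) (hFc.intervalIntegrable _ _)]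
    congr 1
    have : ∫ t in (0 : ℝ)..Real.pi, F (-t) = ∫ t in (-Real.pi)..0, F t := by
      rw [intervalIntegral.integral_comp_neg]; simp
    rw [← this]
    simp_rw [hneg]
    rw [intervalIntegral.integral_of_le Real.pi_pos.le,
      intervalIntegral.integral_of_le Real.pi_pos.le]
    exact integral_conj
  rw [hsplit] at h
  have h' := congrArg Complex.re h
  have e : (2 * (Real.pi : ℂ) * ((PowerSeries.coeff m (genF μ ^ n) : ℝ) : ℂ)).re =
      2 * Real.pi * PowerSeries.coeff m (genF μ ^ n) := by
    rw [← Complex.ofReal_ofNat, ← Complex.ofReal_mul, ← Complex.ofReal_mul, Complex.ofReal_re]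
  rw [e, Complex.add_re, Complex.conj_re] at h'
  have := Real.pi_pos
  field_simp
  linarith

theorem coeff_le_int {μ : ℕ → ℝ} (hnn : ∀ j, 0 ≤ μ j) (hs : Summable μ) (n m : ℕ) :
    PowerSeries.coeff m (genF μ ^ n) ≤ (1 / Real.pi) * ∫ t in (0 : ℝ)..Real.pi, ‖psi μ t‖ ^ n := by
  rw [coeff_eq_re hnn hs]
  refine mul_le_mul_of_nonneg_left ?_ (by positivity)
  refine (Complex.re_le_norm _).trans ?_
  refine (intervalIntegral.norm_integral_le_integral_norm Real.pi_pos.le).trans_eq ?_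
  refine intervalIntegral.integral_congr fun t _ => ?_
  rw [norm_mul, norm_pow, norm_psi,
    show -(Complex.I * ((t * m : ℝ) : ℂ)) = Complex.I * ((-(t * m) : ℝ) : ℂ) by
          push_cast; ring, norm_expI, mul_one]

theorem coeff_eq_psi {μ : ℕ → ℝ} (hnn : ∀ j, 0 ≤ μ j) (hs : Summable μ) (n j : ℕ) (hj : j ≤ n) :
    PowerSeries.coeff (n - j) (genF μ ^ n) = (1 / Real.pi) * (∫ t in (0 : ℝ)..Real.pi,
      psi μ t ^ n * Complex.exp (Complex.I * ((t * j : ℝ) : ℂ))).re := by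
  rw [coeff_eq_re hnn hs]
  congr 3
  funext t
  rw [psi, mul_pow, mul_assoc, ← Complex.exp_nat_mul, ← Complex.exp_add, Nat.cast_sub hj]
  congr 2
  push_cast; ring

theorem norm_phi_lt {μ : ℕ → ℝ} (hnn : ∀ j, 0 ≤ μ j) (hs : HasSum μ 1) (hpos : 0 < μ 0)
    (haper : ∀ d : ℕ, (∀ i : ℕ, 0 < i → 0 < μ i → d ∣ i) → d = 1) {t : ℝ} (ht0 : 0 < t)
    (ht : t ≤ Real.pi) : ‖phi μ t‖ < 1 := by
  refine lt_of_le_of_ne (norm_phi_le hnn hs t) fun heq => ?_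
  set z : ℂ := phi μ t with hz
  have hsm : HasSum (fun k : ℕ => (μ k : ℂ) * Complex.exp (Complex.I * ((t * k : ℝ) : ℂ))) z := by
    have : Summable fun m : ℕ => ‖(μ m : ℂ) * Complex.exp (Complex.I * ((t * m : ℝ) : ℂ))‖ := by
      simpa only [norm_term (hnn _)] using hs.summable
    exact this.of_norm.hasSum
  have hzz : (starRingEnd ℂ) z * z = 1 := by
    rw [mul_comm, Complex.mul_conj, Complex.normSq_eq_norm_sq, heq]; simp
  have h1 := Complex.hasSum_re (hsm.mul_left ((starRingEnd ℂ) z))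
  rw [hzz, Complex.one_re] at h1
  have hre : ∀ k : ℕ, ((starRingEnd ℂ) z * ((μ k : ℂ) *
      Complex.exp (Complex.I * ((t * k : ℝ) : ℂ)))).re =
      μ k * ((starRingEnd ℂ) z * Complex.exp (Complex.I * ((t * k : ℝ) : ℂ))).re := by
    intro k
    rw [mul_left_comm, Complex.re_ofReal_mul]
  simp only [hre] at h1
  have hle : ∀ k : ℕ, ((starRingEnd ℂ) z * Complex.exp (Complex.I * ((t * k : ℝ) : ℂ))).re ≤ 1 := by
    intro k
    refine (Complex.re_le_norm _).trans_eq ?_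
    rw [norm_mul, norm_expI, mul_one, RCLike.norm_conj, heq]
  have h2 := hs.sub h1
  rw [sub_self] at h2
  have h3 := (hasSum_zero_iff_of_nonneg (fun k => by
    have := mul_le_mul_of_nonneg_left (hle k) (hnn k)
    show (0 : ℝ) ≤ _
    rw [mul_one] at this
    exact sub_nonneg.2 this)).1 h2
  have h4 : ∀ k, 0 < μ k →
      (starRingEnd ℂ) z * Complex.exp (Complex.I * ((t * k : ℝ) : ℂ)) = 1 := by
    intro k hk
    have : μ k - μ k * ((starRingEnd ℂ) z *
        Complex.exp (Complex.I * ((t * k : ℝ) : ℂ))).re = 0 := congrFun h3 k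
    have hr : ((starRingEnd ℂ) z * Complex.exp (Complex.I * ((t * k : ℝ) : ℂ))).re = 1 := by
      have : μ k * (1 - ((starRingEnd ℂ) z *
        Complex.exp (Complex.I * ((t * k : ℝ) : ℂ))).re) = 0 := by linarith
      rcases mul_eq_zero.1 this with h | h <;> linarith
    set w := (starRingEnd ℂ) z * Complex.exp (Complex.I * ((t * k : ℝ) : ℂ)) with hw
    have hn : ‖w‖ = 1 := by rw [hw, norm_mul, norm_expI, mul_one, RCLike.norm_conj, heq]
    have hsq : w.re * w.re + w.im * w.im = 1 := by
      rw [← Complex.normSq_apply, Complex.normSq_eq_norm_sq, hn]; norm_num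
    rw [hr] at hsq
    have him : w.im = 0 := by nlinarith
    exact Complex.ext (by simpa using hr) (by simpa using him)
  have hz1 : (starRingEnd ℂ) z = 1 := by simpa using h4 0 hpos
  have hone := haper (orderOf (Complex.exp (Complex.I * (t : ℂ)))) (fun i _ hi => by
    apply orderOf_dvd_of_pow_eq_one
    have := h4 i hi
    rw [hz1, one_mul] at this
    rw [← Complex.exp_nat_mul, ← this]
    congr 1; push_cast; ring)
  rw [orderOf_eq_one_iff, Complex.exp_eq_one_iff] at hone
  obtain ⟨n, hn⟩ := hone
  have hn' : t = n * (2 * Real.pi) := by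
    have h5 : (t : ℂ) = n * (2 * Real.pi) := by
      apply mul_left_cancel₀ Complex.I_ne_zero
      rw [hn]; ring
    exact_mod_cast h5
  have hpi := Real.pi_pos
  have hn1 : (0 : ℝ) < n := by
    by_contra hcon
    push Not at hcon
    nlinarith
  have hn2 : (1 : ℝ) ≤ n := by exact_mod_cast (by exact_mod_cast hn1 : (0 : ℤ) < n)
  nlinarith


/-! ### Regular variation at zero -/

/-- `L` is positive, monotone, and regularly varying at `0+` with index `α`. -/
structure RV0 (L : ℝ → ℝ) (α : ℝ) : Prop where
  pos : ∀ t, 0 < t → 0 < L t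
  mono : ∀ s t, 0 < s → s ≤ t → L s ≤ L t
  rv : ∀ c, 0 < c → Tendsto (fun t => L (c * t) / L t) (nhdsWithin 0 (Ioi 0)) (nhds (c ^ α))

theorem ev_nhds0 {P : ℝ → Prop} (h : ∀ᶠ t in nhdsWithin (0 : ℝ) (Ioi 0), P t) :
    ∃ t0, 0 < t0 ∧ ∀ t, 0 < t → t ≤ t0 → P t := by
  rw [eventually_nhdsWithin_iff, Metric.eventually_nhds_iff] at h
  obtain ⟨e, he, h⟩ := h
  refine ⟨e / 2, by positivity, fun t h0 h1 => h ?_ h0⟩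
  rw [Real.dist_eq, sub_zero, abs_of_pos h0]; linarith

theorem dyadic {x : ℝ} (hx : 1 ≤ x) : ∃ k : ℕ, (2 : ℝ) ^ k ≤ x ∧ x < 2 ^ (k + 1) := by
  obtain ⟨k, h1, h2⟩ := exists_nat_pow_near hx (one_lt_two)
  exact ⟨k, h1, h2⟩

theorem RV0.potter_lower {L : ℝ → ℝ} {α : ℝ} (h : RV0 L α) {β : ℝ} (hβ : 0 ≤ β) (hβα : β < α) :
    ∃ t0, 0 < t0 ∧ ∀ t s, 0 < t → t ≤ s → s ≤ t0 → 2 ^ (-β) * (s / t) ^ β * L t ≤ L s := by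
  have h2 : (2 : ℝ) ^ β < 2 ^ α := Real.rpow_lt_rpow_of_exponent_lt one_lt_two hβα
  obtain ⟨t0, ht0, H⟩ := ev_nhds0 ((tendsto_order.1 (h.rv 2 two_pos)).1 _ h2)
  have step : ∀ t, 0 < t → t ≤ t0 → 2 ^ β * L t ≤ L (2 * t) := fun t a b => by
    have := (lt_div_iff₀ (h.pos t a)).1 (H t a b)
    exact this.le
  have it : ∀ (k : ℕ) t, 0 < t → 2 ^ k * t ≤ t0 → (2 ^ β) ^ k * L t ≤ L (2 ^ k * t) := by
    intro k
    induction k with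
    | zero => intro t _ _; simp
    | succ k ih =>
      intro t ht hk
      have hk' : 2 ^ k * t ≤ t0 := by
        refine le_trans ?_ hk
        rw [pow_succ]
        have : 0 < 2 ^ k * t := by positivity
        nlinarith
      have a := ih t ht hk'
      have b := step (2 ^ k * t) (by positivity) hk'
      calc (2 ^ β) ^ (k + 1) * L t = 2 ^ β * ((2 ^ β) ^ k * L t) := by ring
        _ ≤ 2 ^ β * L (2 ^ k * t) := by gcongr
        _ ≤ L (2 * (2 ^ k * t)) := b
        _ = _ := by congr 1; ring
  refine ⟨t0, ht0, fun t s ht hts hs => ?_⟩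
  obtain ⟨k, hk1, hk2⟩ := dyadic ((one_le_div ht).2 hts)
  have hks : 2 ^ k * t ≤ s := (le_div_iff₀ ht).1 hk1
  have a := it k t ht (hks.trans hs)
  refine le_trans ?_ (a.trans (h.mono _ _ (by positivity) hks))
  have hLt := (h.pos t ht).le
  refine mul_le_mul_of_nonneg_right ?_ hLt
  have : (s / t) ^ β ≤ (2 ^ (k + 1)) ^ β :=
    Real.rpow_le_rpow (by have := ht.trans_le hts; positivity) hk2.le hβ
  calc (2 : ℝ) ^ (-β) * (s / t) ^ β ≤ 2 ^ (-β) * (2 ^ (k + 1)) ^ β := by gcongr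
    _ = (2 ^ β) ^ k := by
      rw [← Real.rpow_natCast 2 (k + 1), ← Real.rpow_mul two_pos.le, ← Real.rpow_add two_pos,
        ← Real.rpow_natCast, ← Real.rpow_mul two_pos.le]
      congr 1; push_cast; ring

theorem RV0.potter_upper {L : ℝ → ℝ} {α : ℝ} (h : RV0 L α) (hα : 0 < α) {γ : ℝ} (hγ : α < γ) {B : ℝ}
    (hB : ∀ t, 0 < t → L t ≤ B) :
    ∃ t0 C, 0 < t0 ∧ 0 < C ∧ ∀ t s, 0 < t → t ≤ t0 → t ≤ s → L s ≤ C * (s / t) ^ γ * L t := by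
  have h2 : (2 : ℝ) ^ α < 2 ^ γ := Real.rpow_lt_rpow_of_exponent_lt one_lt_two hγ
  have hγ0 : 0 < γ := hα.trans hγ
  obtain ⟨t0, ht0, H⟩ := ev_nhds0 ((tendsto_order.1 (h.rv 2 two_pos)).2 _ h2)
  have step : ∀ t, 0 < t → t ≤ t0 → L (2 * t) ≤ 2 ^ γ * L t := fun t a b => by
    have := (div_lt_iff₀ (h.pos t a)).1 (H t a b)
    exact this.le
  have it : ∀ (k : ℕ) t, 0 < t → 2 ^ k * t ≤ t0 → L (2 ^ (k + 1) * t) ≤ (2 ^ γ) ^ (k + 1) * L t := by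
    intro k
    induction k with
    | zero => intro t ht hk; simpa using step t ht (by simpa using hk)
    | succ k ih =>
      intro t ht hk
      have hk' : 2 ^ k * t ≤ t0 := by
        refine le_trans ?_ hk
        rw [pow_succ]
        have : 0 < 2 ^ k * t := by positivity
        nlinarith
      have a := ih t ht hk'
      have b := step (2 ^ (k + 1) * t) (by positivity) hk
      calc L (2 ^ (k + 1 + 1) * t) = L (2 * (2 ^ (k + 1) * t)) := by congr 1; ring
        _ ≤ 2 ^ γ * L (2 ^ (k + 1) * t) := b
        _ ≤ 2 ^ γ * ((2 ^ γ) ^ (k + 1) * L t) := by gcongr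
        _ = _ := by ring
  have main : ∀ t s, 0 < t → t ≤ s → s ≤ t0 → L s ≤ 2 ^ γ * (s / t) ^ γ * L t := by
    intro t s ht hts hs
    obtain ⟨k, hk1, hk2⟩ := dyadic ((one_le_div ht).2 hts)
    have hks : 2 ^ k * t ≤ s := (le_div_iff₀ ht).1 hk1
    have hks2 : s ≤ 2 ^ (k + 1) * t := ((div_lt_iff₀ ht).1 hk2).le
    have a := it k t ht (hks.trans hs)
    refine ((h.mono _ _ (ht.trans_le hts) hks2).trans a).trans ?_
    refine mul_le_mul_of_nonneg_right ?_ (h.pos t ht).le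
    have : (2 ^ k) ^ γ ≤ (s / t) ^ γ := Real.rpow_le_rpow (by positivity) hk1 hγ0.le
    calc ((2 : ℝ) ^ γ) ^ (k + 1) = 2 ^ γ * (2 ^ k) ^ γ := by
          rw [← Real.rpow_natCast 2 k, ← Real.rpow_mul two_pos.le, ← Real.rpow_add two_pos,
            ← Real.rpow_natCast, ← Real.rpow_mul two_pos.le]
          congr 1; push_cast; ring
      _ ≤ _ := by gcongr
  have hB0 : 0 < B := (h.pos t0 ht0).trans_le (hB t0 ht0)
  have hL0 := h.pos t0 ht0
  have hone : 1 ≤ B / L t0 := (one_le_div hL0).2 (hB t0 ht0)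
  refine ⟨t0, B / L t0 * 2 ^ γ, ht0, by positivity, fun t s ht htt hts => ?_⟩
  have hLt := h.pos t ht
  have hs0 := ht.trans_le hts
  rcases le_total s t0 with hs | hs
  · refine (main t s ht hts hs).trans ?_
    have : 0 ≤ 2 ^ γ * (s / t) ^ γ * L t := by positivity
    calc 2 ^ γ * (s / t) ^ γ * L t = 1 * (2 ^ γ * (s / t) ^ γ * L t) := by ring
      _ ≤ B / L t0 * (2 ^ γ * (s / t) ^ γ * L t) := by gcongr
      _ = _ := by ring
  · have a := main t t0 ht htt le_rfl
    have b : (t0 / t) ^ γ ≤ (s / t) ^ γ :=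
      Real.rpow_le_rpow (by positivity) (by gcongr) hγ0.le
    calc L s ≤ B := hB s hs0
      _ = B / L t0 * L t0 := by field_simp
      _ ≤ B / L t0 * (2 ^ γ * (t0 / t) ^ γ * L t) := by gcongr
      _ ≤ B / L t0 * (2 ^ γ * (s / t) ^ γ * L t) := by gcongr
      _ = _ := by ring

/-- Linear Potter bound. -/
theorem RV0.lin {L : ℝ → ℝ} {α : ℝ} (h : RV0 L α) (hα : 1 < α) :
    ∃ t0, 0 < t0 ∧ ∀ t s, 0 < t → t ≤ s → s ≤ t0 → (1 / 2) * (s / t) * L t ≤ L s := by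
  obtain ⟨t0, h0, H⟩ := h.potter_lower zero_le_one hα
  refine ⟨t0, h0, fun t s a b c => ?_⟩
  have := H t s a b c
  rw [Real.rpow_one, Real.rpow_neg_one] at this
  simpa using this

theorem RV0.exists_tn {L : ℝ → ℝ} {α : ℝ} (h : RV0 L α) (hα : 1 < α) :
    ∃ tn : ℕ → ℝ, (∀ n, 0 < tn n) ∧ Tendsto tn atTop (nhds 0) ∧
      Tendsto (fun n : ℕ => n * L (tn n)) atTop (nhds 1) := by
  obtain ⟨t0, ht0, hlin⟩ := h.lin hα
  let S : ℕ → Set ℝ := fun n => {t | 0 < t ∧ t ≤ 1 ∧ n * L t ≤ 1}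
  have hbdd : ∀ n, BddAbove (S n) := fun n => ⟨1, fun t ht => ht.2.1⟩
  have hne : ∀ n, (S n).Nonempty := by
    intro n
    have hL0 := h.pos t0 ht0
    set t := min 1 (t0 / (1 + 2 * n * L t0 )) with htdef
    have hden : 0 < 1 + 2 * n * L t0 := by positivity
    have htpos : 0 < t := lt_min one_pos (by positivity)
    refine ⟨t, htpos, min_le_left _ _, ?_⟩
    have h1 : t ≤ t0 / (1 + 2 * n * L t0) := min_le_right _ _
    have h2 : t * (1 + 2 * n * L t0) ≤ t0 := (le_div_iff₀ hden).1 h1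
    have h3 : t ≤ t0 := by
      refine le_trans ?_ h2
      have : 0 ≤ t * (2 * n * L t0) := by positivity
      linarith
    have h4 := hlin t t0 htpos h3 le_rfl
    have h5 : t0 * L t ≤ 2 * t * L t0 := by
      have : t0 * L t = 2 * t * (1 / 2 * (t0 / t) * L t) := by field_simp
      rw [this]; gcongr
    have h6 : t0 * (n * L t) ≤ t0 * 1 := by
      have : t0 * (n * L t) = n * (t0 * L t) := by ring
      rw [this]
      have : (n : ℝ) * (t0 * L t) ≤ n * (2 * t * L t0) := by gcongr
      linarith
    exact le_of_mul_le_mul_left h6 ht0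
  set tn : ℕ → ℝ := fun n => sSup (S n) with htn
  have hpos : ∀ n, 0 < tn n := by
    intro n
    obtain ⟨t, ht⟩ := hne n
    exact ht.1.trans_le (le_csSup (hbdd n) ht)
  have hlow : ∀ n c, 0 < c → c < tn n → n * L c ≤ 1 := by
    intro n c hc hcn
    obtain ⟨t, ht, hct⟩ := exists_lt_of_lt_csSup (hne n) hcn
    refine le_trans ?_ ht.2.2
    have := h.mono c t hc hct.le
    gcongr
  have hup : ∀ n c, tn n < c → c ≤ 1 → 1 ≤ n * L c := by
    intro n c hc hc1
    by_contra hcon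
    push Not at hcon
    have : c ≤ tn n := le_csSup (hbdd n) ⟨(hpos n).trans hc, hc1, hcon.le⟩
    linarith
  have hzero : Tendsto tn atTop (nhds 0) := by
    rw [Metric.tendsto_atTop]
    intro e he
    set η := min 1 (e / 2)
    have hη : 0 < η := lt_min one_pos (by positivity)
    obtain ⟨N, hN⟩ := exists_nat_gt (1 / L η)
    refine ⟨N, fun n hn => ?_⟩
    rw [Real.dist_eq, sub_zero, abs_of_pos (hpos n)]
    have hη2 : η ≤ e / 2 := min_le_right _ _
    suffices tn n ≤ η by linarith
    by_contra hcon
    push Not at hcon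
    have h1 := hlow n η hη hcon
    have h2 : 1 / L η < n := hN.trans_le (by exact_mod_cast hn)
    rw [div_lt_iff₀ (h.pos _ hη)] at h2
    linarith
  refine ⟨tn, hpos, hzero, ?_⟩
  have hw : Tendsto tn atTop (nhdsWithin 0 (Ioi 0)) :=
    tendsto_nhdsWithin_iff.2 ⟨hzero, Eventually.of_forall hpos⟩
  have hcont : Tendsto (fun c : ℝ => c ^ (-α)) (nhds 1) (nhds 1) := by
    have := (Real.continuousAt_rpow_const 1 (-α) (Or.inl one_ne_zero)).tendsto
    simpa using this
  have hcid : ∀ c, 0 < c → Tendsto (fun n => L (tn n) / L (c * tn n)) atTop (nhds (c ^ (-α))) := by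
    intro c hc
    have := ((h.rv c hc).comp hw).inv₀ (by positivity)
    rw [Real.rpow_neg hc.le]
    refine this.congr fun n => ?_
    simp
  rw [tendsto_order]
  constructor
  · intro a ha
    have h1 : ∀ᶠ c in nhdsWithin (1 : ℝ) (Ioi 1), a < c ^ (-α) :=
      (hcont.mono_left nhdsWithin_le_nhds).eventually (lt_mem_nhds ha)
    obtain ⟨c, hac, hc1⟩ := (h1.and self_mem_nhdsWithin).exists
    have hc1 : 1 < c := hc1
    have hc0 : 0 < c := by linarith
    have h2 := (tendsto_order.1 (hcid c hc0)).1 a hac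
    have h3 : ∀ᶠ n in atTop, c * tn n < 1 := by
      have : Tendsto (fun n => c * tn n) atTop (nhds (c * 0)) := hzero.const_mul c
      rw [mul_zero] at this
      exact this.eventually (gt_mem_nhds one_pos)
    filter_upwards [h2, h3] with n h2 h3
    have hp := hpos n
    have h4 := hup n (c * tn n) (by nlinarith) h3.le
    have h5 := h.pos (c * tn n) (by positivity)
    have h6 := h.pos (tn n) hp
    calc a < L (tn n) / L (c * tn n) := h2
      _ = 1 * (L (tn n) / L (c * tn n)) := by ring
      _ ≤ (n * L (c * tn n)) * (L (tn n) / L (c * tn n)) := by gcongr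
      _ = n * L (tn n) := by field_simp
  · intro a ha
    have h1 : ∀ᶠ c in nhdsWithin (1 : ℝ) (Iio 1), c ^ (-α) < a :=
      (hcont.mono_left nhdsWithin_le_nhds).eventually (gt_mem_nhds ha)
    have h1' : ∀ᶠ c in nhdsWithin (1 : ℝ) (Iio 1), 0 < c :=
      (lt_mem_nhds one_pos).filter_mono nhdsWithin_le_nhds
    obtain ⟨c, ⟨hac, hc0⟩, hc1⟩ := ((h1.and h1').and self_mem_nhdsWithin).exists
    have hc1 : c < 1 := hc1
    have h2 := (tendsto_order.1 (hcid c hc0)).2 a hac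
    filter_upwards [h2] with n h2
    have hp := hpos n
    have h4 := hlow n (c * tn n) (by positivity) (by nlinarith)
    have h5 := h.pos (c * tn n) (by positivity)
    have h6 := h.pos (tn n) hp
    calc n * L (tn n) = (n * L (c * tn n)) * (L (tn n) / L (c * tn n)) := by field_simp
      _ ≤ 1 * (L (tn n) / L (c * tn n)) := by gcongr
      _ < a := by linarith

theorem RV0.tn_compare {L : ℝ → ℝ} {α : ℝ} (h : RV0 L α) (hα : 1 < α) {tn : ℕ → ℝ}
    (hpos : ∀ n, 0 < tn n) (hz : Tendsto tn atTop (nhds 0))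
    (h1 : Tendsto (fun n : ℕ => n * L (tn n)) atTop (nhds 1)) {δ : ℝ} (hδ : 0 < δ) :
    ∃ C N, 0 < C ∧ ∀ n m : ℕ, N ≤ m → m ≤ n → δ * n ≤ m → tn m ≤ C * tn n := by
  obtain ⟨t0, ht0, hlin⟩ := h.lin hα
  have e1 := (tendsto_order.1 h1).1 (1 / 2) (by norm_num)
  have e2 := (tendsto_order.1 h1).2 2 (by norm_num)
  have e3 := (tendsto_order.1 hz).2 t0 ht0
  obtain ⟨N, hN⟩ := eventually_atTop.1 ((e1.and e2).and e3)
  refine ⟨1 + 8 / δ, N, by positivity, fun n m hm hmn hd => ?_⟩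
  obtain ⟨⟨-, m2⟩, m3⟩ := hN m hm
  obtain ⟨⟨n1, -⟩, -⟩ := hN n (hm.trans hmn)
  have hpn := hpos n
  have hpm := hpos m
  rcases le_total (tn m) (tn n) with hle | hle
  · have : 0 ≤ 8 / δ * tn n := by positivity
    linarith
  · have h4 := hlin _ _ hpn hle m3.le
    have hLn := h.pos _ hpn
    have hLm := h.pos _ hpm
    have hn0 : (0 : ℝ) < n := by
      by_contra hc
      have : (n : ℝ) = 0 := le_antisymm (not_lt.1 hc) (by positivity)
      rw [this] at n1; linarith
    have h5 : δ * n * L (tn m) ≤ m * L (tn m) := by gcongr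
    have h6 : δ * n * (1 / 2 * (tn m / tn n) * L (tn n)) ≤ δ * n * L (tn m) := by gcongr
    have h7 : δ * (1 / 2 * (tn m / tn n)) * (n * L (tn n)) ≤ 2 := by
      have : δ * (1 / 2 * (tn m / tn n)) * (n * L (tn n)) =
        δ * n * (1 / 2 * (tn m / tn n) * L (tn n)) := by ring
      linarith
    have h8 : δ * (1 / 2 * (tn m / tn n)) * (1 / 2) ≤ 2 := by
      refine le_trans ?_ h7
      gcongr
    have h9 : tn m / tn n ≤ 8 / δ := by
      rw [le_div_iff₀ hδ]; linarith
    have := (div_le_iff₀ hpn).1 h9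
    linarith

/-- `tn` decays at most linearly. -/
theorem RV0.tn_ge {L : ℝ → ℝ} {α : ℝ} (h : RV0 L α) (hα : 1 < α) {tn : ℕ → ℝ}
    (hpos : ∀ n, 0 < tn n) (hz : Tendsto tn atTop (nhds 0))
    (h1 : Tendsto (fun n : ℕ => n * L (tn n)) atTop (nhds 1)) :
    ∃ c, 0 < c ∧ ∀ᶠ n : ℕ in atTop, c ≤ n * tn n := by
  obtain ⟨t0, ht0, hlin⟩ := h.lin hα
  have e1 := (tendsto_order.1 h1).1 (1 / 2) (by norm_num)
  have e3 := (tendsto_order.1 hz).2 t0 ht0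
  have hL0 := h.pos _ ht0
  refine ⟨t0 / (4 * L t0), by positivity, ?_⟩
  filter_upwards [e1, e3] with n n1 n3
  have hp := hpos n
  have h4 := hlin _ _ hp n3.le le_rfl
  have h5 : 1 / 2 * (t0 / tn n) * L (tn n) * (n * tn n) ≤ L t0 * (n * tn n) := by gcongr
  have h6 : 1 / 2 * (t0 / tn n) * L (tn n) * (n * tn n) = t0 / 2 * (n * L (tn n)) := by
    field_simp
  have h7 : t0 / 2 * (1 / 2) ≤ t0 / 2 * (n * L (tn n)) := by gcongr
  rw [div_le_iff₀ (by positivity)]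
  linarith


/-! ### Local estimates -/

theorem RV0.tendsto_zero {L : ℝ → ℝ} {α : ℝ} (h : RV0 L α) (hα : 1 < α) :
    Tendsto L (nhdsWithin 0 (Ioi 0)) (nhds 0) := by
  obtain ⟨t0, ht0, hlin⟩ := h.lin hα
  have hL0 := h.pos _ ht0
  have hid : Tendsto (fun t : ℝ => 2 * L t0 / t0 * t) (nhdsWithin 0 (Ioi 0)) (nhds 0) := by
    have : Tendsto (fun t : ℝ => 2 * L t0 / t0 * t) (nhds 0) (nhds (2 * L t0 / t0 * 0)) :=
      (continuous_const.mul continuous_id).tendsto 0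
    rw [mul_zero] at this
    exact this.mono_left nhdsWithin_le_nhds
  refine squeeze_zero' ?_ ?_ hid
  · filter_upwards [self_mem_nhdsWithin] with t ht using (h.pos t ht).le
  · filter_upwards [Ioc_mem_nhdsGT ht0] with t ht
    have h4 := hlin t t0 ht.1 ht.2 le_rfl
    have ht1 := ht.1
    have h5 : 2 * t / t0 * (1 / 2 * (t0 / t) * L t) ≤ 2 * t / t0 * L t0 := by gcongr
    have h6 : 2 * t / t0 * (1 / 2 * (t0 / t) * L t) = L t := by field_simp
    rw [h6] at h5
    refine h5.trans_eq ?_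
    ring

theorem psi_exp_bound {L : ℝ → ℝ} {α : ℝ} (h : RV0 L α) (hα : 1 < α) {ψ : ℝ → ℂ} {z0 : ℂ}
    (hz0 : 0 < z0.re)
    (hlim : Tendsto (fun t => (1 - ψ t) / (L t : ℂ)) (nhdsWithin 0 (Ioi 0)) (nhds z0)) :
    ∃ δ c, 0 < δ ∧ 0 < c ∧ ∀ t, 0 < t → t ≤ δ → ‖ψ t‖ ≤ Real.exp (-(c * L t)) := by
  have hre : Tendsto (fun t => ((1 - ψ t) / (L t : ℂ)).re) (nhdsWithin 0 (Ioi 0)) (nhds z0.re) :=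
    (Complex.continuous_re.tendsto z0).comp hlim
  have hnorm : Tendsto (fun t => L t * ‖(1 - ψ t) / (L t : ℂ)‖ ^ 2) (nhdsWithin 0 (Ioi 0))
      (nhds (0 * ‖z0‖ ^ 2)) := (h.tendsto_zero hα).mul (hlim.norm.pow 2)
  rw [zero_mul] at hnorm
  have e1 := (tendsto_order.1 hre).1 (z0.re / 2) (by linarith)
  have e2 := (tendsto_order.1 hnorm).2 (z0.re / 2) (by linarith)
  obtain ⟨δ, hδ, H⟩ := ev_nhds0 (e1.and e2)
  refine ⟨δ, z0.re / 4, hδ, by linarith, fun t ht htd => ?_⟩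
  obtain ⟨a, b⟩ := H t ht htd
  have hL := h.pos t ht
  set w := (1 - ψ t) / (L t : ℂ) with hw
  have hψ : ψ t = 1 - L t * w := by
    have : (L t : ℂ) ≠ 0 := by exact_mod_cast hL.ne'
    rw [hw]; field_simp; ring
  have hsq : ‖ψ t‖ ^ 2 = 1 - 2 * L t * w.re + L t * (L t * ‖w‖ ^ 2) := by
    rw [← Complex.normSq_eq_norm_sq, ← Complex.normSq_eq_norm_sq, hψ, Complex.normSq_apply,
      Complex.normSq_apply]
    simp
    ring
  have h1 : ‖ψ t‖ ^ 2 ≤ 1 - L t * (z0.re / 2) := by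
    rw [hsq]
    nlinarith
  have h2 : 1 - L t * (z0.re / 2) ≤ Real.exp (-(z0.re / 4 * L t)) ^ 2 := by
    rw [← Real.exp_nat_mul]
    have := Real.add_one_le_exp (-(L t * (z0.re / 2)))
    have e : ((2 : ℕ) : ℝ) * -(z0.re / 4 * L t) = -(L t * (z0.re / 2)) := by push_cast; ring
    rw [e]; linarith
  exact (pow_le_pow_iff_left₀ (norm_nonneg _) (Real.exp_pos _).le two_ne_zero).1 (h1.trans h2)

theorem psi_away {ψ : ℝ → ℂ} (hc : Continuous ψ) (hlt : ∀ t, 0 < t → t ≤ Real.pi → ‖ψ t‖ < 1)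
    {δ : ℝ} (hδ : 0 < δ) (hδπ : δ ≤ Real.pi) :
    ∃ ρ, 0 ≤ ρ ∧ ρ < 1 ∧ ∀ t, δ ≤ t → t ≤ Real.pi → ‖ψ t‖ ≤ ρ := by
  obtain ⟨x, hx, hmax⟩ := (isCompact_Icc (a := δ) (b := Real.pi)).exists_isMaxOn
    ⟨δ, le_rfl, hδπ⟩ (hc.norm.continuousOn)
  exact ⟨‖ψ x‖, norm_nonneg _, hlt x (hδ.trans_le hx.1) hx.2, fun t h1 h2 => hmax ⟨h1, h2⟩⟩

/-- Common data for the local estimates. -/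
theorem loc_data {L : ℝ → ℝ} {α : ℝ} (h : RV0 L α) (hα : 1 < α) {ψ : ℝ → ℂ} {z0 : ℂ}
    (hz0 : 0 < z0.re) (hc : Continuous ψ) (hlt : ∀ t, 0 < t → t ≤ Real.pi → ‖ψ t‖ < 1)
    (hlim : Tendsto (fun t => (1 - ψ t) / (L t : ℂ)) (nhdsWithin 0 (Ioi 0)) (nhds z0))
    {tn : ℕ → ℝ} (hpos : ∀ n, 0 < tn n) (hz : Tendsto tn atTop (nhds 0))
    (h1 : Tendsto (fun n : ℕ => n * L (tn n)) atTop (nhds 1)) :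
    ∃ δ a ρ, 0 < δ ∧ δ ≤ Real.pi ∧ 0 < a ∧ 0 ≤ ρ ∧ ρ < 1 ∧
      (∀ t, δ ≤ t → t ≤ Real.pi → ‖ψ t‖ ≤ ρ) ∧
      (∀ᶠ n : ℕ in atTop, ∀ u, 0 < u → tn n * u ≤ δ →
        ‖ψ (tn n * u)‖ ^ n ≤ Real.exp a * Real.exp (-a * u)) := by
  obtain ⟨t0, ht0, hlin⟩ := h.lin hα
  obtain ⟨δ, c, hδ, hcpos, hb⟩ := psi_exp_bound h hα hz0 hlim
  set δ' := min (min δ t0) Real.pi with hδ'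
  have hδ'0 : 0 < δ' := lt_min (lt_min hδ ht0) Real.pi_pos
  have hδ'1 : δ' ≤ δ := (min_le_left _ _).trans (min_le_left _ _)
  have hδ'2 : δ' ≤ t0 := (min_le_left _ _).trans (min_le_right _ _)
  have hδ'3 : δ' ≤ Real.pi := min_le_right _ _
  obtain ⟨ρ, hρ0, hρ1, hρ⟩ := psi_away hc hlt hδ'0 hδ'3
  refine ⟨δ', c / 4, ρ, hδ'0, hδ'3, by positivity, hρ0, hρ1, hρ, ?_⟩
  filter_upwards [(tendsto_order.1 h1).1 (1 / 2) (by norm_num)] with n hn u hu hud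
  have hp := hpos n
  have hu' : 0 < tn n * u := by positivity
  have h2 := hb (tn n * u) hu' (hud.trans hδ'1)
  have hLu := h.pos _ hu'
  rw [← Real.exp_add]
  rcases le_total u 1 with hu1 | hu1
  · have h3 : ‖ψ (tn n * u)‖ ≤ 1 := (hlt _ hu' (hud.trans hδ'3)).le
    calc ‖ψ (tn n * u)‖ ^ n ≤ 1 := pow_le_one₀ (norm_nonneg _) h3
      _ ≤ _ := Real.one_le_exp (by nlinarith)
  · have h4 := hlin (tn n) (tn n * u) hp (by nlinarith) (hud.trans hδ'2)
    have h5 : tn n * u / tn n = u := by field_simp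
    rw [h5] at h4
    calc ‖ψ (tn n * u)‖ ^ n ≤ Real.exp (-(c * L (tn n * u))) ^ n :=
          pow_le_pow_left₀ (norm_nonneg _) h2 n
      _ = Real.exp (-(c * (n * L (tn n * u)))) := by rw [← Real.exp_nat_mul]; congr 1; ring
      _ ≤ _ := by
        apply Real.exp_le_exp.2
        have h6 : (n : ℝ) * (1 / 2 * u * L (tn n)) ≤ n * L (tn n * u) := by gcongr
        have h7 : 1 / 2 * u * (1 / 2) ≤ 1 / 2 * u * (n * L (tn n)) := by gcongr
        have h8 : u / 4 ≤ n * L (tn n * u) := by linarith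
        have h9 : c * (u / 4) ≤ c * (n * L (tn n * u)) := by gcongr
        linarith

theorem rho_small {tn : ℕ → ℝ} (hpos : ∀ n, 0 < tn n) {c ρ : ℝ} (hc : 0 < c)
    (htn : ∀ᶠ n : ℕ in atTop, c ≤ n * tn n) (h0 : 0 ≤ ρ) (h1 : ρ < 1) :
    Tendsto (fun n => ρ ^ n / tn n) atTop (nhds 0) := by
  have h2 := (tendsto_self_mul_const_pow_of_lt_one h0 h1).const_mul (1 / c)
  rw [mul_zero] at h2
  refine squeeze_zero' (Eventually.of_forall fun n => ?_) ?_ h2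
  · have := hpos n; positivity
  · filter_upwards [htn] with n hn
    have := hpos n
    rw [div_le_iff₀ this]
    calc ρ ^ n = (1 / c) * c * ρ ^ n := by field_simp
      _ ≤ (1 / c) * (n * tn n) * ρ ^ n := by gcongr
      _ = _ := by ring

theorem loc_upper {L : ℝ → ℝ} {α : ℝ} (h : RV0 L α) (hα : 1 < α) {ψ : ℝ → ℂ} {z0 : ℂ}
    (hz0 : 0 < z0.re) (hc : Continuous ψ) (hlt : ∀ t, 0 < t → t ≤ Real.pi → ‖ψ t‖ < 1)
    (hlim : Tendsto (fun t => (1 - ψ t) / (L t : ℂ)) (nhdsWithin 0 (Ioi 0)) (nhds z0))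
    {tn : ℕ → ℝ} (hpos : ∀ n, 0 < tn n) (hz : Tendsto tn atTop (nhds 0))
    (h1 : Tendsto (fun n : ℕ => n * L (tn n)) atTop (nhds 1)) :
    ∃ C, 0 < C ∧ ∀ᶠ n : ℕ in atTop, ∫ t in (0 : ℝ)..Real.pi, ‖ψ t‖ ^ n ≤ C * tn n := by
  obtain ⟨δ, a, ρ, hδ, hδπ, ha, hρ0, hρ1, hρ, hb⟩ := loc_data h hα hz0 hc hlt hlim hpos hz h1
  obtain ⟨c, hc0, hcn⟩ := h.tn_ge hα hpos hz h1
  have hr := (tendsto_order.1 (rho_small hpos hc0 hcn hρ0 hρ1)).2 1 one_pos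
  have hgint : MeasureTheory.IntegrableOn (fun u => Real.exp a * Real.exp (-a * u)) (Ioi 0) :=
    (exp_neg_integrableOn_Ioi 0 ha).const_mul _
  set K := ∫ u in Ioi (0 : ℝ), Real.exp a * Real.exp (-a * u) with hK
  have hK0 : 0 ≤ K := MeasureTheory.integral_nonneg fun u => by positivity
  have hπ := Real.pi_pos
  refine ⟨K + Real.pi, by positivity, ?_⟩
  filter_upwards [hb, hr] with n hb hr
  have hp := hpos n
  have hi : ∀ x y, IntervalIntegrable (fun t => ‖ψ t‖ ^ n) MeasureTheory.volume x y := fun x y =>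
    (hc.norm.pow n).intervalIntegrable x y
  rw [← intervalIntegral.integral_add_adjacent_intervals (hi 0 δ) (hi δ Real.pi), add_mul]
  refine add_le_add ?_ ?_
  · have hsub := intervalIntegral.mul_integral_comp_mul_left (a := 0) (b := δ / tn n)
      (f := fun t => ‖ψ t‖ ^ n) (tn n)
    rw [mul_zero, mul_div_cancel₀ _ hp.ne'] at hsub
    rw [← hsub, mul_comm]
    refine mul_le_mul_of_nonneg_right ?_ hp.le
    rw [intervalIntegral.integral_of_le (by positivity)]
    calc ∫ u in Ioc 0 (δ / tn n), ‖ψ (tn n * u)‖ ^ n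
        ≤ ∫ u in Ioc 0 (δ / tn n), Real.exp a * Real.exp (-a * u) := by
          refine MeasureTheory.setIntegral_mono_on ?_
            (hgint.mono_set Ioc_subset_Ioi_self) measurableSet_Ioc fun u hu => ?_
          · have hcont : Continuous fun u => ‖ψ (tn n * u)‖ ^ n := by fun_prop
            exact hcont.integrableOn_Ioc
          · refine hb u hu.1 ?_
            have := (le_div_iff₀ hp).1 hu.2
            linarith
      _ ≤ K := by
          refine MeasureTheory.setIntegral_mono_set hgint ?_
            (Eventually.of_forall Ioc_subset_Ioi_self)
          exact Eventually.of_forall fun u => by positivity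
  · rw [div_lt_one hp] at hr
    have h3 : ∫ t in δ..Real.pi, ‖ψ t‖ ^ n ≤ ∫ t in δ..Real.pi, ρ ^ n := by
      refine intervalIntegral.integral_mono_on hδπ (hi _ _) (by simp) fun t ht => ?_
      exact pow_le_pow_left₀ (norm_nonneg _) (hρ t ht.1 ht.2) n
    refine h3.trans ?_
    rw [intervalIntegral.integral_const, smul_eq_mul]
    have : 0 ≤ ρ ^ n := by positivity
    nlinarith

theorem loc_lim {L : ℝ → ℝ} {α : ℝ} (h : RV0 L α) (hα : 1 < α) {ψ : ℝ → ℂ} {z0 : ℂ}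
    (hz0 : 0 < z0.re) (hc : Continuous ψ) (hlt : ∀ t, 0 < t → t ≤ Real.pi → ‖ψ t‖ < 1)
    (hlim : Tendsto (fun t => (1 - ψ t) / (L t : ℂ)) (nhdsWithin 0 (Ioi 0)) (nhds z0))
    {tn : ℕ → ℝ} (hpos : ∀ n, 0 < tn n) (hz : Tendsto tn atTop (nhds 0))
    (h1 : Tendsto (fun n : ℕ => n * L (tn n)) atTop (nhds 1)) (j : ℕ) :
    Tendsto (fun n : ℕ => (∫ t in (0 : ℝ)..Real.pi, ψ t ^ n *
      Complex.exp (Complex.I * ((t * j : ℝ) : ℂ))) / (tn n : ℂ)) atTop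
      (nhds (∫ u in Ioi (0 : ℝ), Complex.exp (-(z0 * ((u ^ α : ℝ) : ℂ))))) := by
  obtain ⟨δ, a, ρ, hδ, hδπ, ha, hρ0, hρ1, hρ, hb⟩ := loc_data h hα hz0 hc hlt hlim hpos hz h1
  obtain ⟨c, hc0, hcn⟩ := h.tn_ge hα hpos hz h1
  have hr := rho_small hpos hc0 hcn hρ0 hρ1
  have hw : Tendsto tn atTop (nhdsWithin 0 (Ioi 0)) :=
    tendsto_nhdsWithin_iff.2 ⟨hz, Eventually.of_forall hpos⟩
  have hgint : MeasureTheory.IntegrableOn (fun u => Real.exp a * Real.exp (-a * u)) (Ioi 0) :=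
    (exp_neg_integrableOn_Ioi 0 ha).const_mul _
  set G : ℕ → ℝ → ℂ := fun n t => ψ t ^ n * Complex.exp (Complex.I * ((t * j : ℝ) : ℂ)) with hG
  have hGc : ∀ n, Continuous (G n) := fun n => by simp only [hG]; fun_prop
  have hGn : ∀ n t, ‖G n t‖ = ‖ψ t‖ ^ n := fun n t => by
    simp only [hG]; rw [norm_mul, norm_expI, mul_one, norm_pow]
  -- main part
  have hmain : Tendsto (fun n => ∫ u in Ioi (0 : ℝ),
      (Ioc 0 (δ / tn n)).indicator (fun u => G n (tn n * u)) u) atTop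
      (nhds (∫ u in Ioi (0 : ℝ), Complex.exp (-(z0 * ((u ^ α : ℝ) : ℂ))))) := by
    refine MeasureTheory.tendsto_integral_filter_of_dominated_convergence
      (fun u => Real.exp a * Real.exp (-a * u)) ?_ ?_ hgint ?_
    · refine Eventually.of_forall fun n => ?_
      have : Continuous fun u => G n (tn n * u) := (hGc n).comp (by fun_prop)
      exact (this.measurable.indicator measurableSet_Ioc).aestronglyMeasurable
    · filter_upwards [hb] with n hb
      refine Eventually.of_forall fun u => ?_
      by_cases hu : u ∈ Ioc 0 (δ / tn n)
      · rw [indicator_of_mem hu, hGn]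
        refine hb u hu.1 ?_
        have := (le_div_iff₀ (hpos n)).1 hu.2
        linarith
      · rw [indicator_of_notMem hu, norm_zero]; positivity
    · rw [MeasureTheory.ae_restrict_iff' measurableSet_Ioi]
      refine Eventually.of_forall fun u hu => ?_
      have hu : 0 < u := hu
      have htu : Tendsto (fun n => tn n * u) atTop (nhds 0) := by
        simpa using hz.mul_const u
      have hwu : Tendsto (fun n => tn n * u) atTop (nhdsWithin 0 (Ioi 0)) :=
        tendsto_nhdsWithin_iff.2 ⟨htu, Eventually.of_forall fun n => by
          have := hpos n; exact mul_pos this hu⟩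
      have hev : ∀ᶠ n in atTop, G n (tn n * u) =
          (Ioc 0 (δ / tn n)).indicator (fun u => G n (tn n * u)) u := by
        filter_upwards [(tendsto_order.1 htu).2 δ hδ] with n hn
        rw [indicator_of_mem]
        exact ⟨hu, (le_div_iff₀ (hpos n)).2 (by linarith)⟩
      refine Tendsto.congr' hev ?_
      have e1 : Tendsto (fun n : ℕ => (n : ℂ) * (ψ (tn n * u) - 1)) atTop
          (nhds (-(z0 * ((u ^ α : ℝ) : ℂ)))) := by
        have a1 := hlim.comp hwu
        have a2 := (Complex.continuous_ofReal.tendsto _).comp ((h.rv u hu).comp hw)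
        have a3 := (Complex.continuous_ofReal.tendsto _).comp h1
        have a4 := ((a1.mul a2).mul a3).neg
        rw [Complex.ofReal_one, mul_one] at a4
        refine a4.congr fun n => ?_
        have hp := hpos n
        have l1 : (L (tn n) : ℂ) ≠ 0 := by exact_mod_cast (h.pos _ hp).ne'
        have l2 : (L (tn n * u) : ℂ) ≠ 0 := by exact_mod_cast (h.pos _ (mul_pos hp hu)).ne'
        simp only [Function.comp_apply]
        rw [mul_comm u (tn n)]
        push_cast
        field_simp
        ring
      have e2 := Complex.tendsto_one_add_pow_exp_of_tendsto e1
      have e3 : Tendsto (fun n => Complex.exp (Complex.I * ((tn n * u * j : ℝ) : ℂ))) atTop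
          (nhds 1) := by
        have : Continuous fun x : ℝ => Complex.exp (Complex.I * ((x * j : ℝ) : ℂ)) := by fun_prop
        have := (this.tendsto 0).comp htu
        simpa [Function.comp_def] using this
      have e4 := e2.mul e3
      rw [mul_one] at e4
      refine e4.congr' ?_
      filter_upwards [eventually_gt_atTop 0] with n hn
      have hn' : (n : ℂ) ≠ 0 := by exact_mod_cast hn.ne'
      simp only [hG]
      congr 2
      field_simp
      ring
  have hrest : Tendsto (fun n => (∫ t in δ..Real.pi, G n t) / (tn n : ℂ)) atTop (nhds 0) := by
    rw [tendsto_zero_iff_norm_tendsto_zero]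
    have h2 := hr.mul_const (|Real.pi - δ|)
    rw [zero_mul] at h2
    refine squeeze_zero (fun n => norm_nonneg _) (fun n => ?_) h2
    have hp := hpos n
    rw [norm_div, Complex.norm_real, Real.norm_of_nonneg hp.le, div_mul_eq_mul_div]
    refine div_le_div_of_nonneg_right ?_ hp.le
    refine intervalIntegral.norm_integral_le_of_norm_le_const fun t ht => ?_
    rw [uIoc_of_le hδπ] at ht
    rw [hGn]
    exact pow_le_pow_left₀ (norm_nonneg _) (hρ t ht.1.le ht.2) n
  have hsum := hmain.add hrest
  rw [add_zero] at hsum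
  refine hsum.congr fun n => ?_
  have hp := hpos n
  have hpc : (tn n : ℂ) ≠ 0 := by exact_mod_cast hp.ne'
  show _ = (∫ t in (0 : ℝ)..Real.pi, G n t) / (tn n : ℂ)
  rw [← intervalIntegral.integral_add_adjacent_intervals
    ((hGc n).intervalIntegrable 0 δ) ((hGc n).intervalIntegrable δ Real.pi), add_div]
  congr 1
  have hsub := intervalIntegral.smul_integral_comp_mul_left (a := 0) (b := δ / tn n)
      (f := G n) (tn n)
  rw [mul_zero, mul_div_cancel₀ _ hp.ne'] at hsub
  rw [← hsub, intervalIntegral.integral_of_le (by positivity),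
    MeasureTheory.setIntegral_indicator measurableSet_Ioc,
    Set.inter_eq_self_of_subset_right Ioc_subset_Ioi_self, Complex.real_smul,
    mul_div_cancel_left₀ _ hpc]

theorem stable_int_eq {α : ℝ} (hα : 1 < α) {z : ℂ} (hz : 0 < z.re) :
    ∫ u in Ioi (0 : ℝ), Complex.exp (-(z * ((u ^ α : ℝ) : ℂ))) =
      z ^ (((-1 / α : ℝ)) : ℂ) * ((Real.Gamma (1 / α + 1) : ℝ) : ℂ) := by
  have hα0 : 0 < α := by linarith
  set U : Set ℂ := {z | 0 < z.re} with hU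
  have hUo : IsOpen U := isOpen_lt continuous_const Complex.continuous_re
  have hUc : IsPreconnected U := (convex_halfSpace_re_gt 0).isPreconnected
  have hintg : ∀ p : ℝ, 0 < p → ∀ q : ℝ, 0 ≤ q → MeasureTheory.IntegrableOn
      (fun u : ℝ => u ^ q * Real.exp (-p * u ^ α)) (Ioi 0) := fun p hp q hq =>
    integrableOn_rpow_mul_exp_neg_mul_rpow (by linarith) hα0 hp
  have hmeas : ∀ z : ℂ, Measurable fun u : ℝ => Complex.exp (-(z * ((u ^ α : ℝ) : ℂ))) := by
    intro z
    have : Measurable fun u : ℝ => u ^ α := measurable_id.pow_const α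
    fun_prop
  have hnorm : ∀ (z : ℂ) (u : ℝ), ‖Complex.exp (-(z * ((u ^ α : ℝ) : ℂ)))‖ =
      Real.exp (-z.re * u ^ α) := by
    intro z u
    rw [Complex.norm_exp]
    congr 1
    rw [Complex.neg_re, Complex.re_mul_ofReal]; ring
  have hdiff : DifferentiableOn ℂ
      (fun z => ∫ u in Ioi (0 : ℝ), Complex.exp (-(z * ((u ^ α : ℝ) : ℂ)))) U := by
    intro w hw
    have hw : 0 < w.re := hw
    refine DifferentiableAt.differentiableWithinAt ?_
    refine (hasDerivAt_integral_of_dominated_loc_of_deriv_le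
      (F' := fun z (u : ℝ) => -((u ^ α : ℝ) : ℂ) * Complex.exp (-(z * ((u ^ α : ℝ) : ℂ))))
      (s := Metric.ball w (w.re / 2))
      (bound := fun u => u ^ α * Real.exp (-(w.re / 2) * u ^ α))
      (Metric.ball_mem_nhds _ (by positivity)) ?_ ?_ ?_ ?_ ?_ ?_).2.differentiableAt
    · exact Eventually.of_forall fun z => (hmeas z).aestronglyMeasurable
    · refine (hintg w.re hw 0 le_rfl).mono' (hmeas w).aestronglyMeasurable ?_
      refine Eventually.of_forall fun u => ?_
      rw [hnorm]; simp
    · have : Measurable fun u : ℝ => u ^ α := measurable_id.pow_const α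
      have h2 := hmeas w
      exact (by fun_prop : Measurable _).aestronglyMeasurable
    · rw [MeasureTheory.ae_restrict_iff' measurableSet_Ioi]
      refine Eventually.of_forall fun u hu z hz => ?_
      have hu : 0 < u := hu
      have hzr : w.re / 2 ≤ z.re := by
        have h1 : ‖z - w‖ < w.re / 2 := by rwa [← dist_eq_norm]
        have h2 := (abs_le.1 ((Complex.abs_re_le_norm (z - w)))).1
        rw [Complex.sub_re] at h2
        linarith
      have hup : 0 < u ^ α := by positivity
      rw [norm_mul, hnorm, norm_neg, Complex.norm_real, Real.norm_of_nonneg hup.le]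
      refine mul_le_mul_of_nonneg_left (Real.exp_le_exp.2 ?_) hup.le
      nlinarith
    · exact hintg _ (by positivity) _ hα0.le
    · refine Eventually.of_forall fun u z _ => ?_
      have h1 : HasDerivAt (fun z : ℂ => -(z * ((u ^ α : ℝ) : ℂ))) (-((u ^ α : ℝ) : ℂ)) z := by
        have h0 := ((hasDerivAt_id z).mul_const ((u ^ α : ℝ) : ℂ)).neg
        rw [one_mul] at h0
        exact h0
      have h2 := h1.cexp
      rw [mul_comm]
      exact h2
  have hdiff2 : DifferentiableOn ℂ (fun z : ℂ => z ^ (((-1 / α : ℝ)) : ℂ) *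
      ((Real.Gamma (1 / α + 1) : ℝ) : ℂ)) U := by
    intro w hw
    have hw' : w ∈ Complex.slitPlane := Or.inl hw
    exact ((differentiableAt_id.cpow_const hw').mul_const _).differentiableWithinAt
  have h1U : (1 : ℂ) ∈ U := by simp [hU]
  refine (hdiff.analyticOnNhd hUo).eqOn_of_preconnected_of_frequently_eq
    (hdiff2.analyticOnNhd hUo) hUc h1U ?_ hz
  have htend : Tendsto (fun x : ℝ => (x : ℂ)) (nhdsWithin 1 (Ioi 1)) (nhdsWithin 1 {1}ᶜ) := by
    refine tendsto_nhdsWithin_iff.2 ⟨?_, ?_⟩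
    · have := (Complex.continuous_ofReal.tendsto (1 : ℝ)).mono_left
        (nhdsWithin_le_nhds (s := Ioi 1))
      simpa using this
    · filter_upwards [self_mem_nhdsWithin] with x hx
      have hx : 1 < x := hx
      simp only [mem_compl_iff, mem_singleton_iff]
      intro hcon
      have : x = 1 := by exact_mod_cast hcon
      linarith
  refine htend.frequently (Eventually.frequently ?_)
  filter_upwards [self_mem_nhdsWithin] with x hx
  have hx : 0 < x := lt_trans one_pos hx
  have hr := integral_exp_neg_mul_rpow hα0 hx
  rw [← Complex.ofReal_cpow hx.le, ← Complex.ofReal_mul, ← hr, ← integral_complex_ofReal]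
  refine MeasureTheory.integral_congr_ae (Eventually.of_forall fun u => ?_)
  simp

theorem stable_int_pos {z0 : ℂ} (hz0 : 0 < z0.re) {α : ℝ} (hα : 1 < α) :
    0 < (∫ u in Ioi (0 : ℝ), Complex.exp (-(z0 * ((u ^ α : ℝ) : ℂ)))).re := by
  have hα0 : 0 < α := by linarith
  have hp : 0 < 1 / α := by positivity
  rw [stable_int_eq hα hz0, mul_comm, Complex.re_ofReal_mul]
  have hz : z0 ≠ 0 := by rintro rfl; simp at hz0
  have harg : |z0.arg| < Real.pi / 2 := Complex.abs_arg_lt_pi_div_two_iff.2 (Or.inl hz0)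
  refine mul_pos (Real.Gamma_pos_of_pos (by positivity)) ?_
  rw [Complex.cpow_def_of_ne_zero hz, Complex.exp_re]
  refine mul_pos (Real.exp_pos _) (Real.cos_pos_of_mem_Ioo ?_)
  have him : (Complex.log z0 * ((-1 / α : ℝ) : ℂ)).im = z0.arg * (-1 / α) := by
    rw [Complex.im_mul_ofReal, Complex.log_im]
  rw [him]
  have h3 : |z0.arg * (-1 / α)| < Real.pi / 2 := by
    rw [abs_mul, neg_div, abs_neg, abs_of_pos hp]
    have : 1 / α ≤ 1 := by rw [div_le_one hα0]; linarith
    have h0 := abs_nonneg z0.arg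
    nlinarith
  exact ⟨(abs_lt.1 h3).1, (abs_lt.1 h3).2⟩


/-! ### Tails of the offspring law -/

/-- `tailH μ x = μ((x,∞))`. -/
def tailH (μ : ℕ → ℝ) (x : ℝ) : ℝ := ∑' k : ℕ, {m : ℕ | x < m}.indicator μ k

/-- `tailG μ n = μ([n,∞))`. -/
def tailG (μ : ℕ → ℝ) (n : ℕ) : ℝ := ∑' k : ℕ, {m : ℕ | n ≤ m}.indicator μ k

theorem ind_tsum_mono {μ : ℕ → ℝ} (hnn : ∀ j, 0 ≤ μ j) (hs : Summable μ) {A B : Set ℕ}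
    (hAB : A ⊆ B) : ∑' k, A.indicator μ k ≤ ∑' k, B.indicator μ k :=
  (hs.indicator A).tsum_le_tsum
    (fun k => indicator_le_indicator_of_subset hAB hnn k) (hs.indicator B)

theorem tailG_le_tailH {μ : ℕ → ℝ} (hnn : ∀ j, 0 ≤ μ j) (hs : Summable μ) {x : ℝ} {n : ℕ}
    (h : x < n) : tailG μ n ≤ tailH μ x :=
  ind_tsum_mono hnn hs fun m (hm : n ≤ m) => h.trans_le (by exact_mod_cast hm : (n : ℝ) ≤ m)

theorem tailH_le_tailG {μ : ℕ → ℝ} (hnn : ∀ j, 0 ≤ μ j) (hs : Summable μ) {x : ℝ} {n : ℕ}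
    (h : (n : ℝ) ≤ x) : tailH μ x ≤ tailG μ n :=
  ind_tsum_mono hnn hs fun m (hm : x < m) => by
    have : (n : ℝ) ≤ m := h.trans hm.le
    exact_mod_cast this

theorem tailH_anti {μ : ℕ → ℝ} (hnn : ∀ j, 0 ≤ μ j) (hs : Summable μ) {x y : ℝ}
    (h : x ≤ y) : tailH μ y ≤ tailH μ x :=
  ind_tsum_mono hnn hs fun _ (hm : y < _) => h.trans_lt hm

theorem tailH_le {μ : ℕ → ℝ} (hnn : ∀ j, 0 ≤ μ j) (hs : HasSum μ 1) (x : ℝ) :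
    tailH μ x ≤ 1 := by
  have := ind_tsum_mono hnn hs.summable (subset_univ {m : ℕ | x < m})
  rw [indicator_univ, hs.tsum_eq] at this
  exact this

section stabletail
variable {μ : ℕ → ℝ} {α : ℝ} {g : ℝ → ℝ}

theorem tailG_ratio (hg0 : ∀ x : ℝ, 0 < x → 0 < g x)
    (hg : ∀ c : ℝ, 0 < c → Tendsto (fun x => g (c * x) / g x) atTop (nhds 1))
    (hG : ∀ n : ℕ, 1 ≤ n → tailG μ n = g n * (n : ℝ) ^ (-α)) {p q : ℕ} (hp : 0 < p) (hq : 0 < q) :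
    Tendsto (fun m : ℕ => tailG μ (p * m) / tailG μ (q * m)) atTop
      (nhds (((p : ℝ) / q) ^ (-α))) := by
  have hp' : (0 : ℝ) < p := by exact_mod_cast hp
  have hq' : (0 : ℝ) < q := by exact_mod_cast hq
  have h1 := ((hg p hp').div (hg q hq') one_ne_zero).comp tendsto_natCast_atTop_atTop
  have h2 := h1.mul_const (((p : ℝ) / q) ^ (-α))
  rw [div_one, one_mul] at h2
  refine h2.congr' ?_
  filter_upwards [eventually_gt_atTop 0] with m hm
  have hm' : (0 : ℝ) < m := by exact_mod_cast hm
  rw [hG _ (Nat.mul_pos hp hm), hG _ (Nat.mul_pos hq hm)]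
  simp only [Function.comp_apply, Pi.div_apply]
  push_cast
  have g1 := hg0 m hm'
  have g2 := hg0 (p * m) (by positivity)
  have g3 := hg0 (q * m) (by positivity)
  rw [Real.div_rpow hp'.le hq'.le, Real.mul_rpow hp'.le hm'.le, Real.mul_rpow hq'.le hm'.le]
  have r1 := Real.rpow_pos_of_pos hq' (-α)
  have r2 := Real.rpow_pos_of_pos hm' (-α)
  field_simp

theorem tailH_pos (hnn : ∀ j, 0 ≤ μ j) (hs : Summable μ) (hg0 : ∀ x : ℝ, 0 < x → 0 < g x)
    (hG : ∀ n : ℕ, 1 ≤ n → tailG μ n = g n * (n : ℝ) ^ (-α)) (x : ℝ) : 0 < tailH μ x := by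
  obtain ⟨n, hn⟩ := exists_nat_gt (max x 0)
  have hn0 : (0 : ℝ) < n := (le_max_right _ _).trans_lt hn
  refine lt_of_lt_of_le ?_ (tailG_le_tailH hnn hs ((le_max_left _ _).trans_lt hn))
  rw [hG n (by exact_mod_cast hn0)]
  have := hg0 n hn0
  positivity

theorem tailH_ratio (hnn : ∀ j, 0 ≤ μ j) (hs : Summable μ) (hα : 0 < α)
    (hg0 : ∀ x : ℝ, 0 < x → 0 < g x)
    (hg : ∀ c : ℝ, 0 < c → Tendsto (fun x => g (c * x) / g x) atTop (nhds 1))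
    (hG : ∀ n : ℕ, 1 ≤ n → tailG μ n = g n * (n : ℝ) ^ (-α)) {c : ℝ} (hc : 0 < c) :
    Tendsto (fun x : ℝ => tailH μ (c * x) / tailH μ x) atTop (nhds (c ^ (-α))) := by
  have hHpos := tailH_pos hnn hs hg0 hG
  have hGpos : ∀ n : ℕ, 1 ≤ n → 0 < tailG μ n := fun n hn => by
    have hn0 : (0 : ℝ) < n := by exact_mod_cast hn
    rw [hG n hn]
    have := hg0 n hn0
    positivity
  have hcont : Tendsto (fun c : ℝ => c ^ (-α)) (nhds c) (nhds (c ^ (-α))) :=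
    (Real.continuousAt_rpow_const c (-α) (Or.inl hc.ne')).tendsto
  have hrat : ∀ r : ℚ, 0 < (r : ℝ) → ∃ p q : ℕ, 0 < p ∧ 0 < q ∧ (r : ℝ) = (p : ℝ) / q := by
    intro r hr
    have hr0 : 0 < r := by exact_mod_cast hr
    refine ⟨r.num.toNat, r.den, by have := Rat.num_pos.2 hr0; omega, r.den_pos, ?_⟩
    have h1 : ((r.num.toNat : ℤ)) = r.num := Int.toNat_of_nonneg (Rat.num_pos.2 hr0).le
    have h2 : ((r.num.toNat : ℕ) : ℝ) = (r.num : ℝ) := by exact_mod_cast congrArg (Int.cast (R := ℝ)) h1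
    rw [h2]
    exact_mod_cast (Rat.num_div_den r).symm
  have hfl : ∀ q : ℕ, 0 < q → Tendsto (fun x : ℝ => ⌊x / q⌋₊) atTop atTop := fun q hq =>
    tendsto_nat_floor_atTop.comp (tendsto_id.atTop_div_const (by exact_mod_cast hq))
  rw [tendsto_order]
  constructor
  · intro a ha
    have h1 : ∀ᶠ d in nhds c, a < d ^ (-α) := hcont.eventually (lt_mem_nhds ha)
    obtain ⟨e, he, hball⟩ := Metric.eventually_nhds_iff.1 h1
    obtain ⟨r, hr1, hr2⟩ := exists_rat_btwn (show c < c + e by linarith)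
    have har : a < (r : ℝ) ^ (-α) := hball (by
      rw [Real.dist_eq, abs_of_pos (by linarith)]; linarith)
    obtain ⟨p, q, hp, hq, hrpq⟩ := hrat r (hc.trans hr1)
    have hq' : (0 : ℝ) < q := by exact_mod_cast hq
    have hp' : (0 : ℝ) < p := by exact_mod_cast hp
    rw [hrpq] at har hr1
    have h2 := (tailG_ratio hg0 hg hG hp hq).comp (hfl q hq)
    have h3 := (tendsto_order.1 h2).1 a har
    have h4 : ∀ᶠ x : ℝ in atTop, p / ((p : ℝ) / q - c) < x := eventually_gt_atTop _
    have h5 : ∀ᶠ x : ℝ in atTop, 1 ≤ ⌊x / q⌋₊ := (hfl q hq).eventually (eventually_ge_atTop 1)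
    filter_upwards [h3, h4, h5, eventually_gt_atTop 0] with x h3 h4 h5 h6
    refine h3.trans_le ?_
    simp only [Function.comp_apply]
    set m := ⌊x / q⌋₊ with hm
    have hmx : (m : ℝ) ≤ x / q := Nat.floor_le (by positivity)
    have hmx2 : x / q < m + 1 := Nat.lt_floor_add_one _
    have hqm : ((q * m : ℕ) : ℝ) ≤ x := by
      push_cast
      have := (le_div_iff₀ hq').1 hmx
      linarith
    have hpm : c * x < ((p * m : ℕ) : ℝ) := by
      push_cast
      rw [div_lt_iff₀ (by linarith)] at h4
      have : p * (x / q) < p * (m + 1) := by gcongr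
      have e : x * ((p : ℝ) / q - c) = p * (x / q) - c * x := by ring
      rw [e] at h4
      linarith
    have a1 := tailG_le_tailH hnn hs hpm
    have a2 := tailH_le_tailG hnn hs hqm
    exact div_le_div₀ (hHpos _).le a1 (hHpos x) a2
  · intro a ha
    have h1 : ∀ᶠ d in nhds c, d ^ (-α) < a := hcont.eventually (gt_mem_nhds ha)
    obtain ⟨e, he, hball⟩ := Metric.eventually_nhds_iff.1 h1
    obtain ⟨r, hr1, hr2⟩ := exists_rat_btwn (show max (c / 2) (c - e) < c by
      refine max_lt ?_ ?_ <;> linarith)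
    have hr0 : c / 2 < r := (le_max_left _ _).trans_lt hr1
    have hr1 : c - e < r := (le_max_right _ _).trans_lt hr1
    have har : (r : ℝ) ^ (-α) < a := hball (by
      rw [Real.dist_eq, abs_of_neg (by linarith)]; linarith)
    obtain ⟨p, q, hp, hq, hrpq⟩ := hrat r (by linarith)
    have hq' : (0 : ℝ) < q := by exact_mod_cast hq
    have hp' : (0 : ℝ) < p := by exact_mod_cast hp
    rw [hrpq] at har hr2
    have h2 := (tailG_ratio hg0 hg hG hp hq).comp ((tendsto_add_atTop_nat 1).comp (hfl q hq))
    have h3 := (tendsto_order.1 h2).2 a har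
    have h4 : ∀ᶠ x : ℝ in atTop, p / (c - (p : ℝ) / q) < x := eventually_gt_atTop _
    filter_upwards [h3, h4, eventually_gt_atTop 0] with x h3 h4 h6
    refine lt_of_le_of_lt ?_ h3
    simp only [Function.comp_apply]
    set m := ⌊x / q⌋₊ with hm
    have hmx : (m : ℝ) ≤ x / q := Nat.floor_le (by positivity)
    have hmx2 : x / q < m + 1 := Nat.lt_floor_add_one _
    have hqm : x < ((q * (m + 1) : ℕ) : ℝ) := by
      push_cast
      have := (div_lt_iff₀ hq').1 hmx2
      linarith
    have hpm : ((p * (m + 1) : ℕ) : ℝ) ≤ c * x := by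
      push_cast
      rw [div_lt_iff₀ (by linarith)] at h4
      have : (p : ℝ) * m ≤ p * (x / q) := by gcongr
      have e : x * (c - (p : ℝ) / q) = c * x - p * (x / q) := by ring
      rw [e] at h4
      linarith
    have a1 := tailH_le_tailG hnn hs hpm
    have a2 := tailG_le_tailH hnn hs hqm
    exact div_le_div₀ (hGpos _ (Nat.mul_pos hp (Nat.succ_pos m))).le a1
      (hGpos _ (Nat.mul_pos hq (Nat.succ_pos m))) a2

theorem stable_RV0 (hnn : ∀ j, 0 ≤ μ j) (hs : Summable μ) (hα : 0 < α)
    (hg0 : ∀ x : ℝ, 0 < x → 0 < g x)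
    (hg : ∀ c : ℝ, 0 < c → Tendsto (fun x => g (c * x) / g x) atTop (nhds 1))
    (hG : ∀ n : ℕ, 1 ≤ n → tailG μ n = g n * (n : ℝ) ^ (-α)) :
    RV0 (fun t => tailH μ t⁻¹) α where
  pos t _ := tailH_pos hnn hs hg0 hG _
  mono s t hs0 hst := tailH_anti hnn hs (inv_anti₀ hs0 hst)
  rv c hc := by
    have h := (tailH_ratio hnn hs hα hg0 hg hG (inv_pos.2 hc)).comp tendsto_inv_nhdsGT_zero
    rw [Real.inv_rpow hc.le, Real.rpow_neg hc.le, inv_inv] at h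
    refine h.congr fun t => ?_
    simp only [Function.comp_apply, mul_inv]

end stabletail


/-! ### Asymptotics of the characteristic function at zero -/

/-- `e^{iy} - 1 - iy`. -/
def kfun (y : ℝ) : ℂ := Complex.exp (Complex.I * (y : ℂ)) - 1 - Complex.I * (y : ℂ)

theorem norm_expI_sub_one_le (y : ℝ) : ‖Complex.exp (Complex.I * (y : ℂ)) - 1‖ ≤ |y| := by
  have := Real.norm_exp_I_mul_ofReal_sub_one_le (x := y)
  simpa using this

theorem norm_kfun_le_lin (y : ℝ) : ‖kfun y‖ ≤ 2 * |y| := by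
  unfold kfun
  refine (norm_sub_le _ _).trans ?_
  have h1 := norm_expI_sub_one_le y
  have h2 : ‖Complex.I * (y : ℂ)‖ = |y| := by simp
  linarith

theorem norm_kfun_le (y : ℝ) : ‖kfun y‖ ≤ 2 * y ^ 2 := by
  rcases le_total |y| 1 with h | h
  · have h2 : ‖Complex.I * (y : ℂ)‖ = |y| := by simp
    have := Complex.norm_exp_sub_one_sub_id_le (x := Complex.I * (y : ℂ)) (by rw [h2]; exact h)
    rw [h2, sq_abs] at this
    unfold kfun
    nlinarith [sq_nonneg y]
  · refine (norm_kfun_le_lin y).trans ?_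
    rw [← sq_abs y]
    nlinarith

theorem kfun_taylor {y : ℝ} (h : |y| ≤ 1) : ‖kfun y + (y : ℂ) ^ 2 / 2‖ ≤ |y| ^ 3 := by
  have h2 : ‖Complex.I * (y : ℂ)‖ = |y| := by simp
  have := Complex.exp_bound (x := Complex.I * (y : ℂ)) (by rw [h2]; exact h) (n := 3) (by norm_num)
  rw [h2] at this
  have e : Complex.exp (Complex.I * (y : ℂ)) - ∑ m ∈ Finset.range 3,
      (Complex.I * (y : ℂ)) ^ m / (m.factorial : ℂ) = kfun y + (y : ℂ) ^ 2 / 2 := by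
    simp [Finset.sum_range_succ, kfun, mul_pow, Nat.factorial]
    ring
  rw [e] at this
  refine this.trans ?_
  have h3 : (0 : ℝ) ≤ |y| ^ 3 := by positivity
  simp [Nat.factorial]
  nlinarith

theorem one_sub_psi {μ : ℕ → ℝ} (hnn : ∀ j, 0 ≤ μ j) (hs : HasSum μ 1)
    (hcrit : HasSum (fun j : ℕ => (j : ℝ) * μ j) 1) (t : ℝ) :
    HasSum (fun k : ℕ => (μ k : ℂ) * kfun (t * k))
      (kfun t - (1 - psi μ t) * Complex.exp (Complex.I * (t : ℂ))) := by
  have h1 : HasSum (fun k : ℕ => (μ k : ℂ) * Complex.exp (Complex.I * ((t * k : ℝ) : ℂ)))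
      (phi μ t) := by
    have : Summable fun m : ℕ => ‖(μ m : ℂ) * Complex.exp (Complex.I * ((t * m : ℝ) : ℂ))‖ := by
      simpa only [norm_term (hnn _)] using hs.summable
    exact this.of_norm.hasSum
  have h2 : HasSum (fun k => (μ k : ℂ)) 1 := by
    have := Complex.hasSum_ofReal.2 hs
    simpa using this
  have h3 : HasSum (fun k : ℕ => (((k : ℝ) * μ k : ℝ) : ℂ)) 1 := by
    have := Complex.hasSum_ofReal.2 hcrit
    simpa using this
  have h4 := (h1.sub h2).sub (h3.mul_left (Complex.I * (t : ℂ)))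
  have e : kfun t - (1 - psi μ t) * Complex.exp (Complex.I * (t : ℂ)) =
      phi μ t - 1 - Complex.I * (t : ℂ) * 1 := by
    have : psi μ t * Complex.exp (Complex.I * (t : ℂ)) = phi μ t := by
      rw [psi, mul_assoc, ← Complex.exp_add, neg_add_cancel, Complex.exp_zero, mul_one]
    rw [sub_mul, this, kfun]; ring
  rw [e]
  refine Eq.mp (congrArg (fun f : ℕ → ℂ => HasSum f _) (funext fun k => ?_)) h4
  rw [kfun]; push_cast; ring

/-- Transfer from the series to `psi`. -/
theorem psi_lim_of {μ : ℕ → ℝ} (hnn : ∀ j, 0 ≤ μ j) (hs : HasSum μ 1)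
    (hcrit : HasSum (fun j : ℕ => (j : ℝ) * μ j) 1) {L : ℝ → ℝ} {a b : ℂ}
    (h1 : Tendsto (fun t => kfun t / (L t : ℂ)) (nhdsWithin 0 (Ioi 0)) (nhds a))
    (h2 : Tendsto (fun t => (∑' k : ℕ, (μ k : ℂ) * kfun (t * k)) / (L t : ℂ))
      (nhdsWithin 0 (Ioi 0)) (nhds b)) :
    Tendsto (fun t => (1 - psi μ t) / (L t : ℂ)) (nhdsWithin 0 (Ioi 0)) (nhds (a - b)) := by
  have h3 : Tendsto (fun t : ℝ => Complex.exp (-(Complex.I * (t : ℂ)))) (nhdsWithin 0 (Ioi 0))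
      (nhds 1) := by
    have : Continuous fun t : ℝ => Complex.exp (-(Complex.I * (t : ℂ))) := by fun_prop
    have := (this.tendsto 0).mono_left (nhdsWithin_le_nhds (s := Ioi 0))
    simpa using this
  have h4 := (h1.sub h2).mul h3
  rw [mul_one] at h4
  refine h4.congr fun t => ?_
  rw [(one_sub_psi hnn hs hcrit t).tsum_eq, ← sub_div, sub_sub_cancel, div_mul_eq_mul_div,
    mul_assoc, ← Complex.exp_add, add_neg_cancel, Complex.exp_zero, mul_one]

theorem kfun_lim (c : ℝ) : Tendsto (fun t : ℝ => kfun (t * c) / ((t ^ 2 : ℝ) : ℂ))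
    (nhdsWithin 0 (Ioi 0)) (nhds (-((c : ℂ) ^ 2 / 2))) := by
  rw [tendsto_iff_norm_sub_tendsto_zero]
  have h0 : Tendsto (fun t : ℝ => |c| ^ 3 * t) (nhdsWithin 0 (Ioi 0)) (nhds 0) := by
    have : Continuous fun t : ℝ => |c| ^ 3 * t := by fun_prop
    have := (this.tendsto 0).mono_left (nhdsWithin_le_nhds (s := Ioi 0))
    simpa using this
  refine squeeze_zero' (Eventually.of_forall fun t => norm_nonneg _) ?_ h0
  have hpos : (0 : ℝ) < 1 / (|c| + 1) := by positivity
  filter_upwards [Ioc_mem_nhdsGT hpos] with t ht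
  have ht0 := ht.1
  have h1 : |t * c| ≤ 1 := by
    rw [abs_mul, abs_of_pos ht0]
    have := (le_div_iff₀ (by positivity)).1 ht.2
    linarith
  have h2 := kfun_taylor h1
  have htc : (t : ℂ) ≠ 0 := by exact_mod_cast ht0.ne'
  have e : kfun (t * c) / ((t ^ 2 : ℝ) : ℂ) - -((c : ℂ) ^ 2 / 2) =
      (kfun (t * c) + ((t * c : ℝ) : ℂ) ^ 2 / 2) / ((t ^ 2 : ℝ) : ℂ) := by
    push_cast; field_simp; ring
  rw [e, norm_div, Complex.norm_real, Real.norm_of_nonneg (by positivity),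
    div_le_iff₀ (by positivity)]
  refine h2.trans_eq ?_
  rw [abs_mul, abs_of_pos ht0]; ring

theorem finvar_asymp {μ : ℕ → ℝ} (hnn : ∀ j, 0 ≤ μ j) (hs : HasSum μ 1) (hpos : 0 < μ 0)
    (hcrit : HasSum (fun j : ℕ => (j : ℝ) * μ j) 1)
    (hvar : Summable fun k : ℕ => (k : ℝ) ^ 2 * μ k) :
    ∃ (L : ℝ → ℝ) (z0 : ℂ), RV0 L 2 ∧ 0 < z0.re ∧
      Tendsto (fun t => (1 - psi μ t) / (L t : ℂ)) (nhdsWithin 0 (Ioi 0)) (nhds z0) := by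
  set V := ∑' k : ℕ, (k : ℝ) ^ 2 * μ k with hV
  have hV1 : 1 < V := by
    have h1 := (hvar.hasSum.sub (hcrit.mul_left 2)).add hs
    have e : (fun k : ℕ => (k : ℝ) ^ 2 * μ k - 2 * (k * μ k) + μ k) =
        fun k : ℕ => ((k : ℝ) - 1) ^ 2 * μ k := by
      funext k; ring
    rw [e] at h1
    have h2 := le_hasSum h1 0 (fun k _ => mul_nonneg (sq_nonneg _) (hnn k))
    simp at h2
    linarith
  refine ⟨fun t => t ^ 2, -((((1 : ℝ) : ℂ)) ^ 2 / 2) - -((V : ℂ) / 2), ?_, ?_,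
    psi_lim_of hnn hs hcrit ?_ ?_⟩
  · refine ⟨fun t ht => by positivity, fun s t h1 h2 => by gcongr, fun c hc => ?_⟩
    refine tendsto_const_nhds.congr' ?_
    filter_upwards [self_mem_nhdsWithin] with t ht
    have ht : 0 < t := ht
    rw [mul_pow, Real.rpow_two]; field_simp
  · simp; linarith
  · have := kfun_lim 1
    simpa using this
  · have h1 : Tendsto (fun t : ℝ => ∑' k : ℕ, (μ k : ℂ) * (kfun (t * k) / ((t ^ 2 : ℝ) : ℂ)))
        (nhdsWithin 0 (Ioi 0)) (nhds (∑' k : ℕ, (μ k : ℂ) * -(((k : ℝ) : ℂ) ^ 2 / 2))) := by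
      refine tendsto_tsum_of_dominated_convergence (bound := fun k : ℕ => 2 * ((k : ℝ) ^ 2 * μ k))
        (hvar.mul_left 2) (fun k => (kfun_lim k).const_mul _) ?_
      filter_upwards [self_mem_nhdsWithin] with t ht k
      have ht : 0 < t := ht
      rw [norm_mul, norm_div, Complex.norm_real, Complex.norm_real, Real.norm_of_nonneg (hnn k),
        Real.norm_of_nonneg (by positivity)]
      have := norm_kfun_le (t * k)
      have h3 : ‖kfun (t * k)‖ / t ^ 2 ≤ 2 * (k : ℝ) ^ 2 := by
        rw [div_le_iff₀ (by positivity)]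
        refine this.trans_eq ?_
        ring
      calc μ k * (‖kfun (t * k)‖ / t ^ 2) ≤ μ k * (2 * (k : ℝ) ^ 2) :=
            mul_le_mul_of_nonneg_left h3 (hnn k)
        _ = _ := by ring
    have e : ∑' k : ℕ, (μ k : ℂ) * -(((k : ℝ) : ℂ) ^ 2 / 2) = -((V : ℂ) / 2) := by
      rw [hV, Complex.ofReal_tsum, ← neg_div, ← tsum_neg, ← tsum_div_const]
      refine tsum_congr fun k => ?_
      push_cast; ring
    rw [e] at h1
    refine h1.congr fun t => ?_
    rw [← tsum_div_const]
    refine tsum_congr fun k => ?_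
    rw [mul_div_assoc]


/-! ### Stable case -/

/-- The derivative of `kfun`. -/
def kder (y : ℝ) : ℂ := Complex.I * (Complex.exp (Complex.I * (y : ℂ)) - 1)

theorem kder_continuous : Continuous kder := by unfold kder; fun_prop

theorem norm_kder_le (y : ℝ) : ‖kder y‖ ≤ |y| := by
  rw [kder, norm_mul, Complex.norm_I, one_mul]; exact norm_expI_sub_one_le y

theorem norm_kder_le_two (y : ℝ) : ‖kder y‖ ≤ 2 := by
  rw [kder, norm_mul, Complex.norm_I, one_mul]
  refine (norm_sub_le _ _).trans ?_
  rw [norm_expI, norm_one]; norm_num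

theorem kfun_eq_integral (x : ℝ) : kfun x = ∫ y in (0 : ℝ)..x, kder y := by
  have h : ∀ y : ℝ, HasDerivAt kfun (kder y) y := by
    intro y
    have h1 : HasDerivAt (fun y : ℝ => (y : ℂ)) 1 y := Complex.ofRealCLM.hasDerivAt
    have h2 : HasDerivAt (fun y : ℝ => Complex.I * (y : ℂ)) (Complex.I * 1) y :=
      h1.const_mul Complex.I
    have h3 := ((h2.cexp).sub_const 1).sub h2
    have e : kder y = Complex.exp (Complex.I * (y : ℂ)) * (Complex.I * 1) - Complex.I * 1 := by
      rw [kder]; ring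
    rw [e]
    exact h3
  rw [intervalIntegral.integral_eq_sub_of_hasDerivAt (fun y _ => h y)
    (kder_continuous.intervalIntegrable _ _)]
  simp [kfun]

theorem tsum_kfun_eq {μ : ℕ → ℝ} (hnn : ∀ j, 0 ≤ μ j) (hs : HasSum μ 1)
    (hcrit : HasSum (fun j : ℕ => (j : ℝ) * μ j) 1) {t : ℝ} (ht : 0 < t) :
    ∑' k : ℕ, (μ k : ℂ) * kfun (t * k) =
      ∫ y in Ioi (0 : ℝ), kder y * ((tailH μ (y / t) : ℝ) : ℂ) := by
  set F : ℕ → ℝ → ℂ := fun k y => (Ioo 0 (t * k)).indicator (fun y => (μ k : ℂ) * kder y) y with hF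
  have hFi : ∀ k, MeasureTheory.IntegrableOn (F k) (Ioi 0) := by
    intro k
    have h1 : Continuous fun y => (μ k : ℂ) * kder y := by
      have := kder_continuous; fun_prop
    have h2 : MeasureTheory.Integrable (F k) :=
      (MeasureTheory.integrable_indicator_iff measurableSet_Ioo).2
        (h1.integrableOn_Ioc.mono_set Ioo_subset_Ioc_self)
    exact h2.integrableOn
  have hFn : Summable fun k => ∫ y in Ioi (0 : ℝ), ‖F k y‖ := by
    refine Summable.of_nonneg_of_le (fun k => MeasureTheory.integral_nonneg fun y => norm_nonneg _)
      (fun k => ?_) (hcrit.summable.mul_left (2 * t))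
    have e : (fun y => ‖F k y‖) = (Ioo 0 (t * k)).indicator fun y => ‖(μ k : ℂ) * kder y‖ := by
      funext y
      simp only [hF]
      rw [norm_indicator_eq_indicator_norm]
    rw [e, MeasureTheory.setIntegral_indicator measurableSet_Ioo,
      Set.inter_eq_self_of_subset_right Ioo_subset_Ioi_self, ← MeasureTheory.integral_Ioc_eq_integral_Ioo,
      ← intervalIntegral.integral_of_le (by positivity)]
    have hle : ∫ y in (0 : ℝ)..(t * k), ‖(μ k : ℂ) * kder y‖ ≤
        ∫ y in (0 : ℝ)..(t * k), μ k * 2 := by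
      refine intervalIntegral.integral_mono_on (by positivity) ?_ (by simp) fun y _ => ?_
      · have := kder_continuous
        exact (by fun_prop : Continuous fun y => ‖(μ k : ℂ) * kder y‖).intervalIntegrable _ _
      · rw [norm_mul, Complex.norm_real, Real.norm_of_nonneg (hnn k)]
        exact mul_le_mul_of_nonneg_left (norm_kder_le_two y) (hnn k)
    refine hle.trans_eq ?_
    rw [intervalIntegral.integral_const, smul_eq_mul]; ring
  have h1 := MeasureTheory.integral_tsum_of_summable_integral_norm hFi hFn
  have h2 : ∀ k, ∫ y in Ioi (0 : ℝ), F k y = (μ k : ℂ) * kfun (t * k) := by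
    intro k
    simp only [hF]
    rw [MeasureTheory.setIntegral_indicator measurableSet_Ioo,
      Set.inter_eq_self_of_subset_right Ioo_subset_Ioi_self, ← MeasureTheory.integral_Ioc_eq_integral_Ioo,
      ← intervalIntegral.integral_of_le (by positivity), intervalIntegral.integral_const_mul,
      kfun_eq_integral]
  simp only [h2] at h1
  rw [h1]
  refine MeasureTheory.setIntegral_congr_fun measurableSet_Ioi fun y hy => ?_
  have hy : 0 < y := hy
  rw [tailH, Complex.ofReal_tsum, ← tsum_mul_left]
  refine tsum_congr fun k => ?_
  simp only [hF]
  by_cases hk : y / t < k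
  · have hk' := (div_lt_iff₀ ht).1 hk
    rw [indicator_of_mem (show y ∈ Ioo 0 (t * k) from ⟨hy, by linarith⟩),
      indicator_of_mem (show k ∈ {m : ℕ | y / t < m} from hk), mul_comm]
  · have hk' : ¬ y < k * t := fun h => hk ((div_lt_iff₀ ht).2 h)
    rw [indicator_of_notMem (show y ∉ Ioo 0 (t * k) from fun h => hk' (by linarith [h.2])),
      indicator_of_notMem (show k ∉ {m : ℕ | y / t < m} from hk)]
    simp


theorem stable_re_lower {μ : ℕ → ℝ} (hnn : ∀ j, 0 ≤ μ j) (hs : HasSum μ 1)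
    (hcrit : HasSum (fun j : ℕ => (j : ℝ) * μ j) 1) {t : ℝ} (ht : 0 < t) :
    (1 - Real.cos 1) * (tailH μ t⁻¹ - tailH μ (t / 2)⁻¹) ≤
      -(∑' k : ℕ, (μ k : ℂ) * kfun (t * k)).re := by
  have h1 := (one_sub_psi hnn hs hcrit t).summable.hasSum
  have h2 := (Complex.hasSum_re h1).neg
  have hS := hs.summable
  have h3 := (((hS.indicator {m : ℕ | t⁻¹ < m}).hasSum).sub
    ((hS.indicator {m : ℕ | (t / 2)⁻¹ < m}).hasSum)).mul_left (1 - Real.cos 1)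
  refine hasSum_le (fun k => ?_) h3 h2
  have hre : -((μ k : ℂ) * kfun (t * k)).re = μ k * (1 - Real.cos (t * k)) := by
    rw [Complex.re_ofReal_mul, kfun]
    have : (Complex.exp (Complex.I * ((t * k : ℝ) : ℂ))).re = Real.cos (t * k) := by
      rw [mul_comm, Complex.exp_ofReal_mul_I_re]
    rw [Complex.sub_re, Complex.sub_re, this]
    simp
    ring
  rw [hre]
  have hcos : 0 ≤ 1 - Real.cos (t * k) := by linarith [Real.cos_le_one (t * k)]
  have hr := mul_nonneg (hnn k) hcos
  by_cases ha : t⁻¹ < k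
  · by_cases hb : (t / 2)⁻¹ < k
    · rw [indicator_of_mem (show k ∈ {m : ℕ | t⁻¹ < m} from ha),
        indicator_of_mem (show k ∈ {m : ℕ | (t / 2)⁻¹ < m} from hb)]
      simpa using hr
    · rw [indicator_of_mem (show k ∈ {m : ℕ | t⁻¹ < m} from ha),
        indicator_of_notMem (show k ∉ {m : ℕ | (t / 2)⁻¹ < m} from hb), sub_zero, mul_comm]
      refine mul_le_mul_of_nonneg_left ?_ (hnn k)
      have h5 : 1 ≤ t * k := by
        rw [inv_lt_iff_one_lt_mul₀ ht] at ha; linarith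
      have h6 : t * k ≤ 2 := by
        rw [inv_lt_iff_one_lt_mul₀ (by positivity)] at hb; linarith
      have := Real.cos_le_cos_of_nonneg_of_le_pi zero_le_one
        (h6.trans Real.two_le_pi) h5
      linarith
  · have hb : ¬ (t / 2)⁻¹ < k := fun hb => ha (lt_of_le_of_lt
      (inv_anti₀ (by positivity) (by linarith)) hb)
    rw [indicator_of_notMem (show k ∉ {m : ℕ | t⁻¹ < m} from ha),
        indicator_of_notMem (show k ∉ {m : ℕ | (t / 2)⁻¹ < m} from hb)]
    simpa using hr

theorem stable_asymp {μ : ℕ → ℝ} {α : ℝ} (hnn : ∀ j, 0 ≤ μ j) (hs : HasSum μ 1)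
    (hcrit : HasSum (fun j : ℕ => (j : ℝ) * μ j) 1) (hα1 : 1 < α) (hα2 : α < 2)
    (h : RV0 (fun t => tailH μ t⁻¹) α) :
    ∃ (L : ℝ → ℝ) (z0 : ℂ), RV0 L α ∧ 0 < z0.re ∧
      Tendsto (fun t => (1 - psi μ t) / (L t : ℂ)) (nhdsWithin 0 (Ioi 0)) (nhds z0) := by
  set L : ℝ → ℝ := fun t => tailH μ t⁻¹ with hL
  set β := (1 + α) / 2 with hβ
  set γ := (α + 2) / 2 with hγ
  have hβ1 : 1 < β := by rw [hβ]; linarith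
  have hβα : β < α := by rw [hβ]; linarith
  have hγα : α < γ := by rw [hγ]; linarith
  have hγ2 : γ < 2 := by rw [hγ]; linarith
  obtain ⟨t1, ht1, hlow⟩ := h.potter_lower (β := β) (by linarith) hβα
  obtain ⟨t2, C, ht2, hC, hup⟩ := h.potter_upper (by linarith) hγα (B := 1)
    (fun t _ => tailH_le hnn hs _)
  have hLpos := h.pos
  -- square is negligible
  have hsq : Tendsto (fun t : ℝ => t ^ 2 / L t) (nhdsWithin 0 (Ioi 0)) (nhds 0) := by
    set t0 := t2 with ht0
    have hK : Tendsto (fun t : ℝ => C * t0 ^ γ / L t0 * t ^ (2 - γ)) (nhdsWithin 0 (Ioi 0))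
        (nhds 0) := by
      have : ContinuousAt (fun t : ℝ => C * t0 ^ γ / L t0 * t ^ (2 - γ)) 0 :=
        continuousAt_const.mul (Real.continuousAt_rpow_const 0 (2 - γ) (Or.inr (by linarith)))
      have := this.tendsto.mono_left (nhdsWithin_le_nhds (s := Ioi 0))
      rwa [Real.zero_rpow (by linarith), mul_zero] at this
    refine squeeze_zero' ?_ ?_ hK
    · filter_upwards [self_mem_nhdsWithin] with t ht
      have := hLpos t ht
      positivity
    · filter_upwards [Ioc_mem_nhdsGT ht2] with t ht
      have ht' := ht.1
      have hLt := hLpos t ht'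
      have hL0 := hLpos t0 ht2
      have a := hup t t0 ht' ht.2 ht.2
      rw [div_le_iff₀ hLt]
      have e : t ^ 2 = t ^ (2 - γ) * t ^ γ := by
        rw [← Real.rpow_add ht', ← Real.rpow_two]; congr 1; ring
      have e2 : (t0 / t) ^ γ = t0 ^ γ / t ^ γ := Real.div_rpow ht2.le ht'.le γ
      have p1 : 0 < t ^ γ := by positivity
      have p2 : 0 < t ^ (2 - γ) := by positivity
      rw [e2] at a
      rw [e]
      calc t ^ (2 - γ) * t ^ γ = t ^ (2 - γ) * t ^ γ / L t0 * L t0 := by field_simp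
        _ ≤ t ^ (2 - γ) * t ^ γ / L t0 * (C * (t0 ^ γ / t ^ γ) * L t) := by gcongr
        _ = _ := by field_simp
  have hk1 : Tendsto (fun t => kfun t / (L t : ℂ)) (nhdsWithin 0 (Ioi 0)) (nhds 0) := by
    rw [tendsto_zero_iff_norm_tendsto_zero]
    have := hsq.const_mul 2
    rw [mul_zero] at this
    refine squeeze_zero' (Eventually.of_forall fun t => norm_nonneg _) ?_ this
    filter_upwards [self_mem_nhdsWithin] with t ht
    have hLt := hLpos t ht
    rw [norm_div, Complex.norm_real, Real.norm_of_nonneg hLt.le, ← mul_div_assoc]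
    exact div_le_div_of_nonneg_right (norm_kfun_le t) hLt.le
  -- main part
  set b : ℂ := ∫ y in Ioi (0 : ℝ), kder y * (((y⁻¹) ^ α : ℝ) : ℂ) with hb
  set bound : ℝ → ℝ := fun y => if y ≤ 1 then C * y ^ (1 - γ) else 2 * 2 ^ β * y ^ (-β) with hbd
  have hbi : MeasureTheory.IntegrableOn bound (Ioi 0) := by
    rw [← Ioc_union_Ioi_eq_Ioi zero_le_one]
    refine MeasureTheory.IntegrableOn.union ?_ ?_
    · have h1 : MeasureTheory.IntegrableOn (fun y : ℝ => C * y ^ (1 - γ)) (Ioc 0 1) := by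
        have := intervalIntegral.intervalIntegrable_rpow' (a := 0) (b := 1)
          (show -1 < 1 - γ by linarith)
        exact ((intervalIntegrable_iff_integrableOn_Ioc_of_le zero_le_one).1 this).const_mul C
      refine h1.congr_fun (fun y hy => ?_) measurableSet_Ioc
      simp only [hbd]; rw [if_pos hy.2]
    · have h1 : MeasureTheory.IntegrableOn (fun y : ℝ => 2 * 2 ^ β * y ^ (-β)) (Ioi 1) :=
        (integrableOn_Ioi_rpow_of_lt (by linarith) one_pos).const_mul _
      refine h1.congr_fun (fun y hy => ?_) measurableSet_Ioi
      have hy : 1 < y := hy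
      simp only [hbd]; rw [if_neg (by linarith)]
  have hmain : Tendsto (fun t : ℝ => ∫ y in Ioi (0 : ℝ), kder y * ((L (y⁻¹ * t) / L t : ℝ) : ℂ))
      (nhdsWithin 0 (Ioi 0)) (nhds b) := by
    refine MeasureTheory.tendsto_integral_filter_of_dominated_convergence bound ?_ ?_ hbi ?_
    · filter_upwards [self_mem_nhdsWithin] with t ht
      have ht : 0 < t := ht
      refine (kder_continuous.measurable.mul ?_).aestronglyMeasurable
      refine Complex.measurable_ofReal.comp ?_
      refine Measurable.div_const ?_ _
      have : Antitone (tailH μ) := fun x y hxy => tailH_anti hnn hs.summable hxy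
      have h2 := this.measurable
      simp only [hL]
      fun_prop
    · filter_upwards [Ioc_mem_nhdsGT ht1, Ioc_mem_nhdsGT ht2] with t h1 h2
      have ht := h1.1
      rw [MeasureTheory.ae_restrict_iff' measurableSet_Ioi]
      refine Eventually.of_forall fun y hy => ?_
      have hy : 0 < y := hy
      have hLt := hLpos t ht
      have hLy := hLpos (y⁻¹ * t) (by positivity)
      rw [norm_mul, Complex.norm_real, Real.norm_of_nonneg (by positivity)]
      simp only [hbd]
      split_ifs with hy1
      · have hle : t ≤ y⁻¹ * t := by
          have : 1 ≤ y⁻¹ := (one_le_inv₀ hy).2 hy1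
          nlinarith
        have a := hup t (y⁻¹ * t) ht h2.2 hle
        rw [mul_div_assoc, div_self ht.ne', mul_one] at a
        have a2 : L (y⁻¹ * t) / L t ≤ C * y⁻¹ ^ γ := (div_le_iff₀ hLt).2 a
        have a3 := norm_kder_le y
        rw [abs_of_pos hy] at a3
        calc ‖kder y‖ * (L (y⁻¹ * t) / L t) ≤ y * (C * y⁻¹ ^ γ) := by gcongr
          _ = C * y ^ (1 - γ) := by
            rw [Real.inv_rpow hy.le, Real.rpow_sub hy, Real.rpow_one]; ring
      · push Not at hy1
        have hle : y⁻¹ * t ≤ t := by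
          have : y⁻¹ ≤ 1 := inv_le_one_of_one_le₀ hy1.le
          nlinarith
        have a := hlow (y⁻¹ * t) t (by positivity) hle h1.2
        have e : t / (y⁻¹ * t) = y := by field_simp
        rw [e, Real.rpow_neg two_pos.le] at a
        have a2 : L (y⁻¹ * t) / L t ≤ 2 ^ β * y ^ (-β) := by
          rw [div_le_iff₀ hLt, Real.rpow_neg hy.le]
          have p1 : (0 : ℝ) < 2 ^ β := by positivity
          have p2 : (0 : ℝ) < y ^ β := by positivity
          calc L (y⁻¹ * t) = 2 ^ β * (y ^ β)⁻¹ * ((2 ^ β)⁻¹ * y ^ β * L (y⁻¹ * t)) := by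
                field_simp
            _ ≤ _ := by gcongr
        calc ‖kder y‖ * (L (y⁻¹ * t) / L t) ≤ 2 * (2 ^ β * y ^ (-β)) := by
              gcongr; exact norm_kder_le_two y
          _ = _ := by ring
    · rw [MeasureTheory.ae_restrict_iff' measurableSet_Ioi]
      refine Eventually.of_forall fun y hy => ?_
      have hy : 0 < y := hy
      exact ((Complex.continuous_ofReal.tendsto _).comp (h.rv y⁻¹ (by positivity))).const_mul _
  have hk2 : Tendsto (fun t => (∑' k : ℕ, (μ k : ℂ) * kfun (t * k)) / (L t : ℂ))
      (nhdsWithin 0 (Ioi 0)) (nhds b) := by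
    refine hmain.congr' ?_
    filter_upwards [self_mem_nhdsWithin] with t ht
    have ht : 0 < t := ht
    rw [tsum_kfun_eq hnn hs hcrit ht, ← MeasureTheory.integral_div]
    refine MeasureTheory.integral_congr_ae (Eventually.of_forall fun y => ?_)
    simp only [hL]
    rw [mul_inv, inv_inv, ← div_eq_mul_inv, mul_div_assoc]
    push_cast; rfl
  refine ⟨L, 0 - b, h, ?_, psi_lim_of hnn hs hcrit hk1 hk2⟩
  have hre : Tendsto (fun t => -((∑' k : ℕ, (μ k : ℂ) * kfun (t * k)) / (L t : ℂ)).re)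
      (nhdsWithin 0 (Ioi 0)) (nhds (-b.re)) :=
    ((Complex.continuous_re.tendsto b).comp hk2).neg
  have hlw : Tendsto (fun t => (1 - Real.cos 1) * (1 - L (1 / 2 * t) / L t))
      (nhdsWithin 0 (Ioi 0)) (nhds ((1 - Real.cos 1) * (1 - (1 / 2) ^ α))) :=
    ((h.rv (1 / 2) (by norm_num)).const_sub 1).const_mul _
  have hle : (1 - Real.cos 1) * (1 - (1 / 2) ^ α) ≤ -b.re := by
    refine le_of_tendsto_of_tendsto hlw hre ?_
    filter_upwards [self_mem_nhdsWithin] with t ht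
    have ht : 0 < t := ht
    have hLt := hLpos t ht
    have a := stable_re_lower hnn hs hcrit ht
    rw [Complex.div_ofReal_re, ← neg_div, le_div_iff₀ hLt]
    refine le_trans (le_of_eq ?_) a
    have e : (t / 2)⁻¹ = (1 / 2 * t)⁻¹ := by congr 1; ring
    rw [e]
    show (1 - Real.cos 1) * (1 - L (1 / 2 * t) / L t) * L t =
      (1 - Real.cos 1) * (L t - L (1 / 2 * t))
    field_simp
  have p1 : 0 < 1 - Real.cos 1 := by linarith [Real.cos_one_le]
  have p2 : (1 / 2 : ℝ) ^ α < 1 := Real.rpow_lt_one (by norm_num) (by norm_num) (by linarith)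
  have p3 : 0 < (1 - Real.cos 1) * (1 - (1 / 2) ^ α) := mul_pos p1 (by linarith)
  rw [zero_sub, Complex.neg_re]
  linarith

theorem char_asymp {μ : ℕ → ℝ} {α : ℝ} (hnn : ∀ j, 0 ≤ μ j) (hs : HasSum μ 1) (hpos : 0 < μ 0)
    (hcrit : HasSum (fun j : ℕ => (j : ℝ) * μ j) 1) (hα1 : 1 < α) (hdom : DomAttr μ α) :
    ∃ (L : ℝ → ℝ) (z0 : ℂ), RV0 L α ∧ 0 < z0.re ∧
      Tendsto (fun t => (1 - psi μ t) / (L t : ℂ)) (nhdsWithin 0 (Ioi 0)) (nhds z0) := by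
  rcases hdom with ⟨rfl, hv⟩ | ⟨h2, g, hg0, hg, hG⟩
  · exact finvar_asymp hnn hs hpos hcrit hv
  · exact stable_asymp hnn hs hcrit hα1 h2
      (stable_RV0 hnn hs.summable (by linarith) hg0 hg hG)


/-! ### Assembly -/

theorem sum_coeff_mul_le {f g : PowerSeries ℝ} (hf : ∀ n, 0 ≤ PowerSeries.coeff n f)
    (hg : ∀ n, 0 ≤ PowerSeries.coeff n g) (n : ℕ) :
    ∑ m ∈ Finset.range n, PowerSeries.coeff m (f * g) ≤
      (∑ m ∈ Finset.range n, PowerSeries.coeff m f) *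
        ∑ m ∈ Finset.range n, PowerSeries.coeff m g := by
  have h1 : ∀ m, PowerSeries.coeff m (f * g) = ∑ k ∈ Finset.range (m + 1),
      PowerSeries.coeff k f * PowerSeries.coeff (m - k) g := by
    intro m
    rw [PowerSeries.coeff_mul, Finset.Nat.sum_antidiagonal_eq_sum_range_succ
      (fun a b => PowerSeries.coeff a f * PowerSeries.coeff b g)]
  simp only [h1]
  rw [Finset.sum_range_diag_flip n fun a b => PowerSeries.coeff a f * PowerSeries.coeff b g,
    Finset.sum_mul]
  refine Finset.sum_le_sum fun m _ => ?_
  rw [Finset.mul_sum]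
  refine Finset.sum_le_sum_of_subset_of_nonneg ?_ fun k _ _ => mul_nonneg (hf m) (hg k)
  intro k hk
  rw [Finset.mem_range] at *; omega

theorem sum_coeff_pow_le_one {f : PowerSeries ℝ} (hf : ∀ n, 0 ≤ PowerSeries.coeff n f) {n : ℕ}
    (h1 : ∑ m ∈ Finset.range n, PowerSeries.coeff m f ≤ 1) (j : ℕ) :
    ∑ m ∈ Finset.range n, PowerSeries.coeff m (f ^ j) ≤ 1 := by
  induction j with
  | zero =>
    simp only [pow_zero, PowerSeries.coeff_one]
    rw [Finset.sum_ite_eq']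
    split_ifs <;> norm_num
  | succ j ih =>
    rw [pow_succ]
    refine (sum_coeff_mul_le (coeff_pow_nonneg hf j) hf n).trans ?_
    exact mul_le_one₀ ih (Finset.sum_nonneg fun m _ => hf m) h1

theorem genT_nonneg {μ : ℕ → ℝ} (hnn : ∀ j, 0 ≤ μ j) (n : ℕ) :
    0 ≤ PowerSeries.coeff n (genT μ) := by
  rw [coeff_genT]; exact qsz_nonneg hnn n

theorem sum_genT_le_one {μ : ℕ → ℝ} (hnn : ∀ j, 0 ≤ μ j) (hs : HasSum μ 1) (n : ℕ) :
    ∑ m ∈ Finset.range n, PowerSeries.coeff m (genT μ) ≤ 1 := by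
  induction n with
  | zero => simp
  | succ n ih =>
    rw [Finset.sum_range_succ', coeff_genT μ 0, qsz_zero, add_zero]
    have h : ∀ m ∈ Finset.range n, PowerSeries.coeff (m + 1) (genT μ) ≤
        ∑ j ∈ Finset.range (n + 1), μ j * PowerSeries.coeff m (genT μ ^ j) := by
      intro m hm
      rw [Finset.mem_range] at hm
      rw [coeff_genT, qsz_succ]
      refine Finset.sum_le_sum_of_subset_of_nonneg ?_ fun j _ _ =>
        mul_nonneg (hnn j) (coeff_pow_nonneg (genT_nonneg hnn) j m)
      intro k hk
      rw [Finset.mem_range] at *; omega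
    refine (Finset.sum_le_sum h).trans ?_
    rw [Finset.sum_comm]
    refine le_trans (Finset.sum_le_sum fun j _ => ?_) (sum_le_hasSum (Finset.range (n + 1))
      (fun i _ => hnn i) hs)
    rw [← Finset.mul_sum]
    exact mul_le_of_le_one_right (hnn j) (sum_coeff_pow_le_one (genT_nonneg hnn) ih j)

theorem summable_genT_pow {μ : ℕ → ℝ} (hnn : ∀ j, 0 ≤ μ j) (hs : HasSum μ 1) (j : ℕ) :
    Summable fun n => PowerSeries.coeff n (genT μ ^ j) :=
  summable_of_sum_range_le (coeff_pow_nonneg (genT_nonneg hnn) j)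
    fun n => sum_coeff_pow_le_one (genT_nonneg hnn) (sum_genT_le_one hnn hs n) j

/-- Local estimates for the forest sizes. -/
structure LocB (μ : ℕ → ℝ) (B : ℕ → ℝ) : Prop where
  pos : ∀ n, 0 < B n
  upper : ∃ C, 0 < C ∧ ∀ᶠ n : ℕ in atTop, ∀ j : ℕ,
    PowerSeries.coeff n (genT μ ^ j) ≤ C * j * B n
  lower : ∀ j : ℕ, 1 ≤ j → ∃ c, 0 < c ∧ ∀ᶠ n : ℕ in atTop,
    c * B n ≤ PowerSeries.coeff n (genT μ ^ j)
  cmp : ∀ δ : ℝ, 0 < δ → δ ≤ 1 → ∃ C N, 0 < C ∧ ∀ n m : ℕ, N ≤ m → m ≤ n → δ * n ≤ m →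
    B m ≤ C * B n

theorem exists_locB {μ : ℕ → ℝ} {α : ℝ} (hnn : ∀ j, 0 ≤ μ j) (hs : HasSum μ 1) (hpos : 0 < μ 0)
    (hcrit : HasSum (fun j : ℕ => (j : ℝ) * μ j) 1)
    (haper : ∀ d : ℕ, (∀ i : ℕ, 0 < i → 0 < μ i → d ∣ i) → d = 1)
    (hα1 : 1 < α) (hdom : DomAttr μ α) : ∃ B, LocB μ B := by
  obtain ⟨L, z0, hL, hz0, hlim⟩ := char_asymp hnn hs hpos hcrit hα1 hdom
  obtain ⟨tn, htp, htz, ht1⟩ := hL.exists_tn hα1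
  have hlt : ∀ t, 0 < t → t ≤ Real.pi → ‖psi μ t‖ < 1 := fun t h0 h1 => by
    rw [norm_psi]; exact norm_phi_lt hnn hs hpos haper h0 h1
  have hc := psi_continuous hnn hs.summable
  obtain ⟨C, hC, hup⟩ := loc_upper hL hα1 hz0 hc hlt hlim htp htz ht1
  have hpi := Real.pi_pos
  refine ⟨fun n => tn n / (n + 1), fun n => div_pos (htp n) (by positivity), ?_, ?_, ?_⟩
  · refine ⟨2 * (C / Real.pi), by positivity, ?_⟩
    filter_upwards [hup, eventually_ge_atTop 1] with n hn hn1 j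
    have hB : 0 < tn n := htp n
    rcases lt_or_ge n j with hj | hj
    · rw [coeff_genT_pow_of_lt μ j n hj]; positivity
    have hk := kemperman μ n j hj
    have hn0 : (1 : ℝ) ≤ n := by exact_mod_cast hn1
    have hF : PowerSeries.coeff (n - j) (genF μ ^ n) ≤ C / Real.pi * tn n := by
      refine (coeff_le_int hnn hs.summable n (n - j)).trans ?_
      calc _ ≤ 1 / Real.pi * (C * tn n) := mul_le_mul_of_nonneg_left hn (by positivity)
        _ = _ := by ring
    have h2 : (n : ℝ) * PowerSeries.coeff n (genT μ ^ j) ≤ n * (j * (C / Real.pi * tn n) / n) := by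
      rw [hk, mul_div_cancel₀ _ (by positivity)]
      exact mul_le_mul_of_nonneg_left hF (by positivity)
    have h3 := le_of_mul_le_mul_left h2 (by linarith)
    refine h3.trans ?_
    rw [div_le_iff₀ (by linarith)]
    have h4 : 1 ≤ 2 * (n : ℝ) / (n + 1) := by
      rw [le_div_iff₀ (by linarith)]; linarith
    calc j * (C / Real.pi * tn n) = j * (C / Real.pi * tn n) * 1 := by ring
      _ ≤ j * (C / Real.pi * tn n) * (2 * (n : ℝ) / (n + 1)) :=
        mul_le_mul_of_nonneg_left h4 (by positivity)
      _ = _ := by ring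
  · intro j hj
    have hl := loc_lim hL hα1 hz0 hc hlt hlim htp htz ht1 j
    set I := ∫ u in Ioi (0 : ℝ), Complex.exp (-(z0 * ((u ^ α : ℝ) : ℂ))) with hI
    have hI0 : 0 < I.re := stable_int_pos hz0 hα1
    have hl' := (Complex.continuous_re.tendsto _).comp hl
    have he := (tendsto_order.1 hl').1 (I.re / 2) (by linarith)
    refine ⟨1 / Real.pi * (I.re / 2), by positivity, ?_⟩
    filter_upwards [he, eventually_ge_atTop (j + 1)] with n hn hnj
    have hn0 : (1 : ℝ) ≤ n := by exact_mod_cast (by omega : 1 ≤ n)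
    have hj0 : (1 : ℝ) ≤ j := by exact_mod_cast hj
    have hk := kemperman μ n j (by omega)
    rw [coeff_eq_psi hnn hs.summable n j (by omega)] at hk
    simp only [Function.comp, Complex.div_ofReal_re] at hn
    rw [lt_div_iff₀ (htp n)] at hn
    set X := (∫ t in (0 : ℝ)..Real.pi,
      psi μ t ^ n * Complex.exp (Complex.I * ((t * j : ℝ) : ℂ))).re with hX
    have hXp : 0 < X := lt_trans (mul_pos (by linarith) (htp n)) hn
    have h5 : 1 / Real.pi * (I.re / 2 * tn n) ≤ n * PowerSeries.coeff n (genT μ ^ j) := by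
      rw [hk]
      calc _ ≤ 1 / Real.pi * X := mul_le_mul_of_nonneg_left hn.le (by positivity)
        _ = 1 * (1 / Real.pi * X) := by ring
        _ ≤ _ := mul_le_mul_of_nonneg_right hj0 (by positivity)
    have h6 := coeff_pow_nonneg (genT_nonneg hnn) j n
    rw [← mul_div_assoc, div_le_iff₀ (by linarith)]
    nlinarith
  · intro δ hδ hδ1
    obtain ⟨D, N, hD, hDN⟩ := hL.tn_compare hα1 htp htz ht1 hδ
    refine ⟨D / δ, N, by positivity, fun n m h1 h2 h3 => ?_⟩
    have h4 := hDN n m h1 h2 h3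
    have hn0 : (0 : ℝ) ≤ n := by positivity
    have hm0 : (0 : ℝ) ≤ m := by positivity
    rw [div_mul_div_comm]
    refine div_le_div₀ (mul_pos hD (htp n)).le h4 (by positivity) ?_
    nlinarith

theorem genQ_nonneg {μ : ℕ → ℝ} (hnn : ∀ j, 0 ≤ μ j) (p : ℕ → Prop) (n : ℕ) :
    0 ≤ PowerSeries.coeff n (genQ μ p) := by
  classical
  simp only [genQ, PowerSeries.coeff_mk]
  split_ifs
  · exact qsz_nonneg hnn n
  · exact le_rfl

theorem genQ_mono {μ : ℕ → ℝ} (hnn : ∀ j, 0 ≤ μ j) {p p' : ℕ → Prop} (h : ∀ l, p l → p' l)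
    (j n : ℕ) :
    PowerSeries.coeff n (genQ μ p ^ j) ≤ PowerSeries.coeff n (genQ μ p' ^ j) := by
  classical
  refine coeff_pow_mono (genQ_nonneg hnn p) (fun l => ?_) j n
  simp only [genQ, PowerSeries.coeff_mk]
  by_cases hp : p l
  · rw [if_pos hp, if_pos (h l hp)]
  · rw [if_neg hp]
    split_ifs
    · exact qsz_nonneg hnn l
    · exact le_rfl

theorem small_forest {μ B : ℕ → ℝ} (hnn : ∀ j, 0 ≤ μ j) (hs : HasSum μ 1) (hB : LocB μ B) (j : ℕ) :
    ∀ ε : ℝ, 0 < ε → ε < 1 → ∀ η : ℝ, 0 < η → ∀ᶠ n : ℕ in atTop,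
      PowerSeries.coeff n ((genQ μ fun l => (l : ℝ) ≤ (1 - ε) * n) ^ j) ≤ η * B n := by
  classical
  induction j with
  | zero =>
    intro ε _ _ η hη
    filter_upwards [eventually_ge_atTop 1] with n hn
    rw [pow_zero, PowerSeries.coeff_one, if_neg (by omega)]
    exact mul_nonneg hη.le (hB.pos n).le
  | succ j ih =>
    intro ε hε hε1 η hη
    obtain ⟨C, hC, hup⟩ := hB.upper
    obtain ⟨D, N, hD, hcmp⟩ := hB.cmp (ε / 2) (by linarith) (by linarith)
    have hih := ih (ε / 2) (by linarith) (by linarith) (η / (2 * D)) (by positivity)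
    obtain ⟨N1, hN1⟩ := eventually_atTop.1 (hup.and hih)
    obtain ⟨s, hsv⟩ := summable_iff_vanishing_norm.1 (summable_genT_pow hnn hs j)
      (η / (2 * (C * D))) (by positivity)
    have hev : Tendsto (fun n : ℕ => ε / 2 * (n : ℝ)) atTop atTop :=
      Tendsto.const_mul_atTop (by linarith) tendsto_natCast_atTop_atTop
    filter_upwards [hev.eventually_ge_atTop (N : ℝ), hev.eventually_ge_atTop (N1 : ℝ),
      hev.eventually_gt_atTop (s.sup id : ℕ)] with n hn hn1 hns
    set f := genQ μ fun l => (l : ℝ) ≤ (1 - ε) * n with hf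
    have hBn := hB.pos n
    have hn0 : (0 : ℝ) ≤ n := by positivity
    have hfT : ∀ k, PowerSeries.coeff k (f ^ j) ≤ PowerSeries.coeff k (genT μ ^ j) :=
      fun k => genQ_mono hnn (fun _ _ => trivial) j k
    have hT0 : ∀ k, 0 ≤ PowerSeries.coeff k (genT μ ^ j) := coeff_pow_nonneg (genT_nonneg hnn) j
    have hf0 : ∀ k, 0 ≤ PowerSeries.coeff k (f ^ j) := coeff_pow_nonneg (genQ_nonneg hnn _) j
    have hfl : ∀ l, PowerSeries.coeff l f = if (l : ℝ) ≤ (1 - ε) * n then qsz μ l else 0 :=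
      fun l => by rw [hf, genQ, PowerSeries.coeff_mk]
    rw [pow_succ', PowerSeries.coeff_mul, Finset.Nat.sum_antidiagonal_eq_sum_range_succ
      (fun a b => PowerSeries.coeff a f * PowerSeries.coeff b (f ^ j))]
    let h : ℕ → ℝ := fun k => if ε * n ≤ k then PowerSeries.coeff k (genT μ ^ j) else 0
    have hh0 : ∀ k, 0 ≤ h k := fun k => by
      simp only [h]; split_ifs
      · exact hT0 k
      · exact le_rfl
    have hterm : ∀ l ∈ Finset.range (n + 1), PowerSeries.coeff l f * PowerSeries.coeff (n - l) (f ^ j)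
        ≤ PowerSeries.coeff l (genT μ) * (η / 2 * B n) + C * D * B n * h (n - l) := by
      intro l hl
      have hl : l ≤ n := by rw [Finset.mem_range] at hl; omega
      have hcast : ((n - l : ℕ) : ℝ) = n - l := by push_cast [hl]; ring
      have hln : (l : ℝ) ≤ n := by exact_mod_cast hl
      have hq := qsz_nonneg hnn l
      have ht1 : 0 ≤ PowerSeries.coeff l (genT μ) * (η / 2 * B n) :=
        mul_nonneg (genT_nonneg hnn l) (by positivity)
      have ht2 : 0 ≤ C * D * B n * h (n - l) := mul_nonneg (by positivity) (hh0 _)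
      rw [hfl]
      by_cases hlx : (l : ℝ) ≤ (1 - ε) * n
      swap
      · rw [if_neg hlx, zero_mul]; linarith
      rw [if_pos hlx]
      rcases le_or_gt (ε / 2 * n) (l : ℝ) with hlb | hlb
      · have h1 : h (n - l) = PowerSeries.coeff (n - l) (genT μ ^ j) := by
          simp only [h]; rw [if_pos]; rw [hcast]; linarith
        have h2 := (hN1 l (by exact_mod_cast hn1.trans hlb)).1 1
        rw [pow_one, coeff_genT] at h2
        have h3 := hcmp n l (by exact_mod_cast hn.trans hlb) hl hlb
        have h4 : qsz μ l ≤ C * D * B n := by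
          refine h2.trans ?_
          have := mul_le_mul_of_nonneg_left h3 hC.le
          push_cast; linarith
        have h5 := mul_le_mul h4 (hfT (n - l)) (hf0 _) (by positivity)
        rw [h1]; linarith
      · have hm : ε / 2 * n ≤ ((n - l : ℕ) : ℝ) := by rw [hcast]; nlinarith
        have h2 := (hN1 (n - l) (by exact_mod_cast hn1.trans hm)).2
        have h3 := hcmp n (n - l) (by exact_mod_cast hn.trans hm) (by omega) hm
        have h4 : PowerSeries.coeff (n - l) (f ^ j) ≤ η / 2 * B n := by
          refine le_trans (genQ_mono hnn (fun i hi => ?_) j (n - l)) (h2.trans ?_)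
          · refine hi.trans ?_
            rw [hcast]
            nlinarith [mul_nonneg hn0 (sq_nonneg ε)]
          · calc _ ≤ η / (2 * D) * (D * B n) := mul_le_mul_of_nonneg_left h3 (by positivity)
              _ = _ := by field_simp
        have h5 := mul_le_mul_of_nonneg_left h4 hq
        rw [coeff_genT]; linarith
    refine (Finset.sum_le_sum hterm).trans ?_
    rw [Finset.sum_add_distrib, ← Finset.sum_mul, ← Finset.mul_sum]
    have hA := mul_le_mul_of_nonneg_right (sum_genT_le_one hnn hs (n + 1))
      (show 0 ≤ η / 2 * B n by positivity)
    have hR : ∑ l ∈ Finset.range (n + 1), h (n - l) = ∑ k ∈ Finset.range (n + 1), h k := by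
      rw [← Finset.sum_range_reflect h (n + 1)]
      rfl
    have hS : ∑ k ∈ Finset.range (n + 1), h k ≤ η / (2 * (C * D)) := by
      rw [← Finset.sum_filter]
      refine (le_abs_self _).trans (hsv _ ?_).le
      rw [Finset.disjoint_left]
      intro k hk hks
      rw [Finset.mem_filter] at hk
      have h1 : k ≤ s.sup id := Finset.le_sup (f := id) hks
      have h2 : (k : ℝ) ≤ (s.sup id : ℕ) := by exact_mod_cast h1
      nlinarith [hk.2]
    rw [hR]
    have hE := mul_le_mul_of_nonneg_left hS (show 0 ≤ C * D * B n by positivity)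
    have hE' : C * D * B n * (η / (2 * (C * D))) = η / 2 * B n := by field_simp
    linarith

/-- Let `μ_∅` be a probability measure on `{1,2,…}` with finite mean and
`μ` a critical aperiodic probability measure on `ℤ₊` in the domain of attraction of a stable
law of index `α ∈ (1,2]`. Denoting by `M` the size of the largest subtree grafted on a child
of the root, `M/n → 1` in probability under `BGW_n^{μ_∅,μ}`: for every `ε > 0`,
`BGW_n^{μ_∅,μ}(M ≤ (1-ε)n) → 0` as `n → ∞`. -/
theorem largest_root_subtree_in_probability (μ0 μ : ℕ → ℝ) (m0 α : ℝ)
    (hμ0nn : ∀ j, 0 ≤ μ0 j) (hμ00 : μ0 0 = 0) (hμ0sum : HasSum μ0 1)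
    (hμ0mean : HasSum (fun j : ℕ => (j : ℝ) * μ0 j) m0)
    (hμnn : ∀ j, 0 ≤ μ j) (hμsum : HasSum μ 1)
    (hμpos : 0 < μ 0) (hμ01 : μ 0 + μ 1 < 1)
    (hcrit : HasSum (fun j : ℕ => (j : ℝ) * μ j) 1)
    (haper : ∀ d : ℕ, (∀ i : ℕ, 0 < i → 0 < μ i → d ∣ i) → d = 1)
    (hα1 : 1 < α) (hα2 : α ≤ 2) (hdom : DomAttr μ α)
    (ε : ℝ) (hε : 0 < ε) :
    Tendsto (fun n : ℕ =>
        (∑ᶠ τ ∈ {τ : PlaneTree | τ.verts.card = n ∧ (τ.maxSub : ℝ) ≤ (1 - ε) * n},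
          bgwModW μ0 μ τ) / bgwModMass μ0 μ n)
      atTop (nhds 0) := by
  obtain ⟨B, hB⟩ := exists_locB hμnn hμsum hμpos hcrit haper hα1 hdom
  obtain ⟨C, hC, hup⟩ := hB.upper
  obtain ⟨j0, hj0⟩ : ∃ j, 0 < μ0 j := by
    by_contra! h
    have h0 : μ0 = fun _ => 0 := funext fun j => le_antisymm (h j) (hμ0nn j)
    rw [h0] at hμ0sum
    exact zero_ne_one (hasSum_zero.unique hμ0sum)
  have hj01 : 1 ≤ j0 := by
    rcases Nat.eq_zero_or_pos j0 with h | h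
    · rw [h, hμ00] at hj0; exact absurd hj0 (lt_irrefl _)
    · exact h
  obtain ⟨c, hc, hlow⟩ := hB.lower j0 hj01
  set ε' : ℝ := min ε 1 / 2 with hε'
  have hm0 : 0 < min ε 1 := lt_min hε one_pos
  have hm1 : min ε 1 ≤ 1 := min_le_right _ _
  have hmε : min ε 1 ≤ ε := min_le_left _ _
  have he0 : 0 < ε' := by rw [hε']; linarith
  have he1 : ε' < 1 := by rw [hε']; linarith
  let Nj : ℕ → ℕ → ℝ := fun n j =>
    PowerSeries.coeff n ((genQ μ fun l => (l : ℝ) ≤ (1 - ε') * n) ^ j)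
  have hN0 : ∀ n j, 0 ≤ Nj n j := fun n j => coeff_pow_nonneg (genQ_nonneg hμnn _) j n
  have hNT : ∀ n j, Nj n j ≤ PowerSeries.coeff n (genT μ ^ j) :=
    fun n j => genQ_mono hμnn (fun _ _ => trivial) j n
  have hbs : Summable fun j : ℕ => C * ((j : ℝ) * μ0 j) := hμ0mean.summable.mul_left C
  have hbd : ∀ᶠ n in atTop, ∀ j, μ0 j * (Nj n j / B n) ≤ C * ((j : ℝ) * μ0 j) := by
    filter_upwards [hup] with n hn j
    have h1 : Nj n j / B n ≤ C * j := by
      rw [div_le_iff₀ (hB.pos n)]; exact (hNT n j).trans (hn j)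
    have := mul_le_mul_of_nonneg_left h1 (hμ0nn j)
    linarith
  have ht0 : ∀ n j, 0 ≤ μ0 j * (Nj n j / B n) := fun n j =>
    mul_nonneg (hμ0nn j) (div_nonneg (hN0 n j) (hB.pos n).le)
  have hlim : Tendsto (fun n => ∑' j, μ0 j * (Nj n j / B n)) atTop (nhds (∑' _ : ℕ, (0 : ℝ))) := by
    refine tendsto_tsum_of_dominated_convergence hbs (fun j => ?_) ?_
    · have h1 : Tendsto (fun n => Nj n j / B n) atTop (nhds 0) := by
        rw [tendsto_order]
        refine ⟨fun a ha => Eventually.of_forall fun n =>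
          ha.trans_le (div_nonneg (hN0 n j) (hB.pos n).le), fun a ha => ?_⟩
        filter_upwards [small_forest hμnn hμsum hB j ε' he0 he1 (a / 2) (by linarith)] with n hn
        have : Nj n j / B n ≤ a / 2 := by rw [div_le_iff₀ (hB.pos n)]; exact hn
        linarith
      simpa using h1.const_mul (μ0 j)
    · filter_upwards [hbd] with n hn j
      rw [Real.norm_of_nonneg (ht0 n j)]
      exact hn j
  rw [tsum_zero] at hlim
  rw [← tendsto_add_atTop_iff_nat 1]
  have hlim2 := hlim.const_mul (1 / (μ0 j0 * c))
  rw [mul_zero] at hlim2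
  have hT0 : ∀ n j, 0 ≤ PowerSeries.coeff n (genT μ ^ j) :=
    fun n j => coeff_pow_nonneg (genT_nonneg hμnn) j n
  have hev : ∀ᶠ n : ℕ in atTop, (1 - ε) * ((n + 1 : ℕ) : ℝ) ≤ (1 - ε') * n := by
    have h1 : Tendsto (fun n : ℕ => ε' * (n : ℝ)) atTop atTop :=
      Tendsto.const_mul_atTop he0 tendsto_natCast_atTop_atTop
    filter_upwards [h1.eventually_ge_atTop 1] with n hn
    have hn0 : (0 : ℝ) ≤ n := by positivity
    have h2 : 2 * ε' ≤ ε := by rw [hε']; linarith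
    push_cast
    nlinarith
  refine tendsto_of_tendsto_of_tendsto_of_le_of_le' tendsto_const_nhds hlim2 ?_ ?_
  · refine Eventually.of_forall fun n => div_nonneg ?_ ?_
    · refine finsum_nonneg fun τ => finsum_nonneg fun _ => ?_
      exact mul_nonneg (hμ0nn _) (Finset.prod_nonneg fun _ _ => hμnn _)
    · rw [bgwModMass_eq]
      exact Finset.sum_nonneg fun j _ => mul_nonneg (hμ0nn j) (hT0 n j)
  · filter_upwards [hbd, hlow, hev, eventually_ge_atTop j0] with n hb hl he hnj
    have hBn := hB.pos n
    have hmass : μ0 j0 * c * B n ≤ bgwModMass μ0 μ (n + 1) := by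
      rw [bgwModMass_eq]
      have h1 := Finset.single_le_sum (f := fun j => μ0 j * PowerSeries.coeff n (genT μ ^ j))
        (fun j _ => mul_nonneg (hμ0nn j) (hT0 n j)) (Finset.mem_range.2 (by omega : j0 < n + 1))
      refine le_trans ?_ h1
      have := mul_le_mul_of_nonneg_left hl hj0.le
      linarith
    have hsum : Summable fun j => μ0 j * (Nj n j / B n) :=
      Summable.of_nonneg_of_le (ht0 n) hb hbs
    have hnum := numerator_le μ0 μ hμ0nn hμnn n ((1 - ε) * ((n + 1 : ℕ) : ℝ))
    have hnum2 : ∑ j ∈ Finset.range (n + 1), μ0 j *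
        PowerSeries.coeff n ((genQ μ fun l => (l : ℝ) ≤ (1 - ε) * ((n + 1 : ℕ) : ℝ)) ^ j) ≤
        B n * ∑' j, μ0 j * (Nj n j / B n) := by
      refine le_trans ?_ (mul_le_mul_of_nonneg_left
        (hsum.sum_le_tsum (Finset.range (n + 1)) fun j _ => ht0 n j) hBn.le)
      rw [Finset.mul_sum]
      refine Finset.sum_le_sum fun j _ => ?_
      have h1 : PowerSeries.coeff n
          ((genQ μ fun l => (l : ℝ) ≤ (1 - ε) * ((n + 1 : ℕ) : ℝ)) ^ j) ≤ Nj n j :=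
        genQ_mono hμnn (fun l hl => hl.trans he) j n
      refine (mul_le_mul_of_nonneg_left h1 (hμ0nn j)).trans_eq ?_
      field_simp
    have hS0 : 0 ≤ ∑' j, μ0 j * (Nj n j / B n) := tsum_nonneg (ht0 n)
    have hcp : 0 < μ0 j0 * c := mul_pos hj0 hc
    rw [div_le_iff₀ (lt_of_lt_of_le (mul_pos hcp hBn) hmass)]
    refine (hnum.trans hnum2).trans ?_
    calc B n * ∑' j, μ0 j * (Nj n j / B n)
        = 1 / (μ0 j0 * c) * (∑' j, μ0 j * (Nj n j / B n)) * (μ0 j0 * c * B n) := by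
          field_simp
      _ ≤ _ := mul_le_mul_of_nonneg_left hmass (mul_nonneg (by positivity) hS0)

end
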